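/- Let G₁ and G₂ be finitely presented groups, and let N₁ ⊴ G₁, N₂ ⊴ G₂ be normal subgroups with G₁' ≤ N₁, G₂' ≤ N₂ and G₁/N₁ ≅ G₂/N₂. Assume there exist finitely generated subgroups K₁, K₂ with N₁ ≤ K₁ ≤ G₁ and N₂ ≤ K₂ ≤ G₂ whose co-ranks are m and k respectively (i.e. the torsion-free rank of G₁/K₁ is m and of G₂/K₂ is k), and such that k + m = rk G₁/N₁ = rk G₂/N₂. Then there exists an isomorphism μ : G₁/N₁ → G₂/N₂ such that the fibre product H_μ = {(g₁,g₂) ∈ G₁ × G₂ : μ(g₁N₁) = g₂N₂} is finitely presented; in particular there is a finitely presented normal fibre product H in G₁ × G₂ with H ∩ G₁ = N₁ and H ∩ G₂ = N₂. -/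

import Mathlib

/-- A group is finitely presented if it is the quotient of a finitely generated free group
by the normal closure of finitely many relators. -/
def FinitelyPresentedGroup (G : Type*) [Group G] : Prop :=
  ∃ (n : ℕ) (f : FreeGroup (Fin n) →* G) (S : Finset (FreeGroup (Fin n))),
    Function.Surjective f ∧ f.ker = Subgroup.normalClosure (S : Set (FreeGroup (Fin n)))

/-- The torsion-free rank of the abelianization of `G`, i.e. `rk G/G'`. -/
noncomputable def rkAb (G : Type*) [Group G] : ℕ :=
  Module.finrank ℤ (Additive (Abelianization G))

/-- The torsion-free rank of the quotient `G ⧸ K` (for `K` a normal subgroup). -/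
noncomputable def rkQuot {G : Type*} [Group G] (K : Subgroup G) (hK : K.Normal) : ℕ :=
  letI := hK
  rkAb (G ⧸ K)

/-- The fibre product associated to an isomorphism `μ : G₁⧸N₁ ≃* G₂⧸N₂`. -/
def fibreProduct {G₁ G₂ : Type*} [Group G₁] [Group G₂]
    (N₁ : Subgroup G₁) (N₂ : Subgroup G₂) [N₁.Normal] [N₂.Normal]
    (μ : (G₁ ⧸ N₁) ≃* (G₂ ⧸ N₂)) : Subgroup (G₁ × G₂) where
  carrier := {p | μ (QuotientGroup.mk p.1) = QuotientGroup.mk p.2}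
  one_mem' := by simp
  mul_mem' := by
    intro a b ha hb
    simp only [Set.mem_setOf_eq] at *
    rw [Prod.fst_mul, Prod.snd_mul, QuotientGroup.mk_mul, QuotientGroup.mk_mul, map_mul, ha, hb]
  inv_mem' := by
    intro a ha
    simp only [Set.mem_setOf_eq] at *
    rw [Prod.fst_inv, Prod.snd_inv, QuotientGroup.mk_inv, QuotientGroup.mk_inv, map_inv, ha]


/-! ### Part 1: the commutation lemma -/

namespace FibreFP

section Conj
variable {G : Type*} [Group G]

/-- right conjugation `x ^ g`. -/
def cj (g x : G) : G := g⁻¹ * x * g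

lemma cj_def (g x : G) : cj g x = g⁻¹ * x * g := rfl
lemma cj_one_left (x : G) : cj 1 x = x := by simp [cj]
lemma cj_mul_left (g h x : G) : cj (g * h) x = cj h (cj g x) := by simp [cj, mul_assoc]
lemma cj_cj (g h x : G) : cj h (cj g x) = cj (cj h g) (cj h x) := by simp [cj, mul_assoc]
lemma cj_of_commute {g x : G} (h : Commute x g) : cj g x = x := by
  rw [cj, mul_assoc, h.eq, inv_mul_cancel_left]

/-- conjugation as a homomorphism -/
def cjH (g : G) : G →* G where
  toFun := cj g
  map_one' := by simp [cj]
  map_mul' := by intro a b; simp [cj, mul_assoc]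

lemma commute_cj_iff (g a c : G) : Commute (cj g a) (cj g c) ↔ Commute a c := by
  constructor
  · intro h
    have := h.map (cjH g⁻¹)
    simpa [cjH, cj, mul_assoc] using this
  · intro h
    exact h.map (cjH g)

lemma cj_inv_cj (g x : G) : cj g (cj g⁻¹ x) = x := by simp [cj, mul_assoc]

lemma cj_mem (S : Subgroup G) {g x : G} (hg : g ∈ S) (hx : x ∈ S) : cj g x ∈ S :=
  S.mul_mem (S.mul_mem (S.inv_mem hg) hx) hg

lemma map_cj {H : Type*} [Group H] (f : G →* H) (g x : G) : f (cj g x) = cj (f g) (f x) := by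
  simp [cj]

variable {ι κ : Type*}

/-- subgroup generated by conjugates of the `x i` by words of length at most `r` in the `b j`. -/
def cl (x : ι → G) (b : κ → G) (r : ℕ) : Subgroup G :=
  Subgroup.closure {z | ∃ (l : List κ) (i : ι), l.length ≤ r ∧ z = cj (l.map b).prod (x i)}

variable {x : ι → G} {b : κ → G}

lemma cl_gen (l : List κ) (i : ι) {r : ℕ} (h : l.length ≤ r) :
    cj (l.map b).prod (x i) ∈ cl x b r :=
  Subgroup.subset_closure ⟨l, i, h, rfl⟩

lemma cl_mono {r s : ℕ} (h : r ≤ s) : cl x b r ≤ cl x b s := by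
  apply Subgroup.closure_mono
  rintro z ⟨l, i, hl, rfl⟩
  exact ⟨l, i, hl.trans h, rfl⟩

lemma cl_base (i : ι) (r : ℕ) : x i ∈ cl x b r := by
  have := cl_gen (x := x) (b := b) [] i (Nat.zero_le r)
  simpa [cj_one_left] using this

lemma cl_le {r : ℕ} {S : Subgroup G}
    (h : ∀ (l : List κ) (i : ι), l.length ≤ r → cj (l.map b).prod (x i) ∈ S) : cl x b r ≤ S := by
  refine (Subgroup.closure_le _).2 ?_
  rintro z ⟨l, i, hl, rfl⟩
  exact h l i hl

lemma cl_cj_le {r : ℕ} {S : Subgroup G} (g : G)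
    (h : ∀ (l : List κ) (i : ι), l.length ≤ r → cj g (cj (l.map b).prod (x i)) ∈ S)
    {z : G} (hz : z ∈ cl x b r) : cj g z ∈ S := by
  have : cl x b r ≤ S.comap (cjH g) := cl_le h
  exact this hz

lemma cl_cj {r : ℕ} (j : κ) {z : G} (hz : z ∈ cl x b r) : cj (b j) z ∈ cl x b (r + 1) := by
  refine cl_cj_le _ ?_ hz
  intro l i hl
  rw [← cj_mul_left]
  have := cl_gen (x := x) (b := b) (l ++ [j]) i (r := r + 1) (by simpa using hl)
  simpa using this

lemma cl_commute {r : ℕ} {w : G}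
    (h : ∀ (l : List κ) (i : ι), l.length ≤ r → Commute (cj (l.map b).prod (x i)) w)
    {z : G} (hz : z ∈ cl x b r) : Commute z w := by
  have : cl x b r ≤ Subgroup.centralizer {w} := by
    refine cl_le fun l i hl => ?_
    rw [Subgroup.mem_centralizer_singleton_iff]
    exact (h l i hl).eq
  exact Subgroup.mem_centralizer_singleton_iff.1 (this hz)

lemma map_cl {H : Type*} [Group H] (f : G →* H) (r : ℕ) :
    (cl x b r).map f = cl (f ∘ x) (f ∘ b) r := by
  rw [cl, MonoidHom.map_closure, cl]
  congr 1
  ext z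
  constructor
  · rintro ⟨_, ⟨l, i, hl, rfl⟩, rfl⟩
    exact ⟨l, i, hl, by simp [map_cj, map_list_prod]⟩
  · rintro ⟨l, i, hl, rfl⟩
    exact ⟨_, ⟨l, i, hl, rfl⟩, by simp [map_cj, map_list_prod]⟩

end Conj

section Comm
variable {G : Type*} [Group G] {ιA ιB ιC ιX ιY : Type*}

/-- The (finitely many) relations that force the commutation. -/
structure Rels (a : ιA → G) (b : ιB → G) (c : ιC → G) (x : ιX → G) (y : ιY → G)
    (D L L₂ M R : ℕ) : Prop where
  hbb : ∀ i j, ∃ s t, b i * b j = x s * y t * (b j * b i)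
  hbb' : ∀ i j, ∃ s t, b i * b j = b j * b i * (x s * y t)
  hbinv : ∀ i, ∃ j, b j = (b i)⁻¹
  hcinv : ∀ i, ∃ j, c j = (c i)⁻¹
  hba : ∀ i j, ∃ s, ∃ w ∈ cl y (Sum.elim b c) L₂, b i * a j = x s * w * (a j * b i)
  hbc : ∀ i j, ∃ s t, b i * c j = x s * y t * (c j * b i)
  hxa : ∀ i j, cj (a j) (x i) ∈ cl x b D
  hxc : ∀ i j, cj (c j) (x i) ∈ cl x b D
  htype : ∀ i, (∃ e s t, 0 < e ∧ e ≤ M ∧ b i ^ e = x s * y t) ∨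
    ∃ j, (∃ s t, b i * a j = a j * b i * (x s * y t)) ∧
      ∀ t, cj ((b i ^ L)⁻¹ * a j) (y t) ∈ cl y (Sum.elim b c) D
  haa : ∀ j, ∃ j' s, ∃ w ∈ cl y (Sum.elim b c) L₂, a j * a j' = x s * w
  hcom : ∀ (l : List ιB) s t, l.length ≤ R → Commute (cj (l.map b).prod (x s)) (y t)

variable {a : ιA → G} {b : ιB → G} {c : ιC → G} {x : ιX → G} {y : ιY → G}
    {D L L₂ M R : ℕ}

lemma move_step {h z : G} {ρ : ℕ} {s : ιX} {w : G} {i : ιB}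
    (h1 : cj h z ∈ cl x b (ρ + D)) (hxs : cj h (x s) ∈ cl x b D)
    (heq : b i * h = x s * w * (h * b i)) (hzw : Commute z w) (hxw : Commute (x s) w) :
    cj h (cj (b i) z) ∈ cl x b (ρ + 1 + D) := by
  rw [← cj_mul_left, heq, cj_mul_left, cj_mul_left, cj_mul_left]
  have hc : Commute (cj (x s) z) w := (hxw.inv_left.mul_left hzw).mul_left hxw
  rw [cj_of_commute hc, cj_cj (x s) h z]
  have : cj (cj h (x s)) (cj h z) ∈ cl x b (ρ + D) :=
    cj_mem _ (cl_mono (by omega) hxs) h1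
  have := cl_cj (b := b) i this
  rwa [show ρ + 1 + D = ρ + D + 1 by omega]

lemma move {h : G} {ρ : ℕ} (hx : ∀ i, cj h (x i) ∈ cl x b D)
    (hb : ∀ i, ∃ s w, b i * h = x s * w * (h * b i) ∧ ∀ z ∈ cl x b ρ, Commute z w)
    {ρ' : ℕ} (hρ : ρ' ≤ ρ + 1) {z : G} (hz : z ∈ cl x b ρ') : cj h z ∈ cl x b (ρ' + D) := by
  refine cl_cj_le _ ?_ hz
  intro l s hl
  suffices H : ∀ l : List ιB, l.length ≤ ρ + 1 →
      cj h (cj (l.map b).prod (x s)) ∈ cl x b (l.length + D) from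
    cl_mono (by omega) (H l (by omega))
  clear hl l
  intro l
  induction l using List.reverseRecOn with
  | nil => intro _; simpa [cj_one_left] using hx s
  | append_singleton l i ih =>
    intro hl
    simp only [List.length_append, List.length_singleton] at hl
    obtain ⟨s', w, he, hw⟩ := hb i
    have h1 := ih (by omega)
    have h2 := move_step h1 (hx s') he (hw _ (cl_gen l s (by omega))) (hw _ (cl_base s' _))
    simpa [cj_mul_left] using h2

/-- the commutation statement up to length `r`. -/
def CC (b : ιB → G) (x : ιX → G) (y : ιY → G) (r : ℕ) : Prop :=
  ∀ (l : List ιB) s t, l.length ≤ r → Commute (cj (l.map b).prod (x s)) (y t)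

lemma CC.comm {r : ℕ} (h : CC b x y r) {z : G} (hz : z ∈ cl x b r) (t : ιY) : Commute z (y t) :=
  cl_commute (fun l i hl => h l i t hl) hz


lemma inv_word_mem (T : Rels a b c x y D L L₂ M R) {r : ℕ} (hr : CC b x y r) (hD : 1 ≤ D) (l : List (ιB ⊕ ιC)) :
    ∀ {ρ : ℕ} {z : G}, ρ + D * l.length ≤ r → z ∈ cl x b ρ →
      cj (l.map (Sum.elim b c)).prod⁻¹ z ∈ cl x b (ρ + D * l.length) := by
  induction l with
  | nil => intro ρ z _ hz; simpa [cj_one_left] using hz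
  | cons k l ih =>
    intro ρ z hρ hz
    simp only [List.length_cons, mul_add, mul_one] at hρ ⊢
    have h1 := ih (by omega) hz
    rw [List.map_cons, List.prod_cons, mul_inv_rev, cj_mul_left]
    cases k with
    | inl i =>
      obtain ⟨j, hj⟩ := T.hbinv i
      simp only [Sum.elim_inl]
      rw [← hj]
      exact cl_mono (by omega) (cl_cj j h1)
    | inr i =>
      obtain ⟨j, hj⟩ := T.hcinv i
      simp only [Sum.elim_inr]
      rw [← hj, ← add_assoc]
      refine move (ρ := r) (fun i => T.hxc i j) ?_ (by omega) h1
      intro i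
      obtain ⟨s, t, he⟩ := T.hbc i j
      exact ⟨s, y t, he, fun z hz => hr.comm hz t⟩

lemma comm_Y (T : Rels a b c x y D L L₂ M R) {r : ℕ} (hr : CC b x y r) (hD : 1 ≤ D) {ρ ℓ : ℕ} (h : ρ + D * ℓ ≤ r)
    {z w : G} (hz : z ∈ cl x b ρ) (hw : w ∈ cl y (Sum.elim b c) ℓ) : Commute z w := by
  refine (cl_commute ?_ hw).symm
  intro l t hl
  have hl' : D * l.length ≤ D * ℓ := Nat.mul_le_mul_left _ hl
  have h1 := inv_word_mem T hr hD l (ρ := ρ) (z := z) (by omega) hz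
  have h2 := hr.comm (cl_mono (by omega) h1) t
  rw [← commute_cj_iff (l.map (Sum.elim b c)).prod, cj_inv_cj] at h2
  exact h2.symm

lemma swap_step (T : Rels a b c x y D L L₂ M R) {r : ℕ} (hr : CC b x y r) (h2 : 2 ≤ r) (p q : List ιB) (i j : ιB)
    (hl : (p ++ i :: j :: q).length = r + 1)
    (h : ∀ s t, Commute (cj ((p ++ j :: i :: q).map b).prod (x s)) (y t)) :
    ∀ s t, Commute (cj ((p ++ i :: j :: q).map b).prod (x s)) (y t) := by
  intro s t
  have h := h s t
  simp only [List.length_append, List.length_cons] at hl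
  simp only [List.map_append, List.map_cons, List.prod_append, List.prod_cons] at h ⊢
  rcases Nat.eq_zero_or_pos p.length with hp | hp
  · have hp' : p = [] := List.length_eq_zero_iff.1 hp
    subst hp'
    obtain ⟨s', t', he⟩ := T.hbb' i j
    simp only [List.map_nil, List.prod_nil, one_mul, List.length_nil] at h hl ⊢
    have hz : cj (b j * b i) (x s) ∈ cl x b r := by
      have := cl_gen (x := x) (b := b) [j, i] s (r := r) (by simpa using h2)
      simpa using this
    rw [← mul_assoc, he, cj_mul_left, cj_mul_left, cj_mul_left (x s')]
    rw [← mul_assoc, cj_mul_left] at h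
    set z := cj (b j * b i) (x s)
    have hc : Commute (cj (x s') z) (y t') :=
      hr.comm (cj_mem _ (cl_base s' _) hz) t'
    rw [cj_of_commute hc, cj_cj]
    have hu := hr.comm (cl_gen (x := x) (b := b) q s' (r := r) (by omega)) t
    exact (hu.inv_left.mul_left h).mul_left hu
  · obtain ⟨s', t', he⟩ := T.hbb i j
    have hz : cj (p.map b).prod (x s) ∈ cl x b r := cl_gen p s (by omega)
    rw [cj_mul_left] at h ⊢
    set z := cj (p.map b).prod (x s)
    rw [← mul_assoc, he, mul_assoc, cj_mul_left, cj_mul_left (x s')]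
    have hc : Commute (cj (x s') z) (y t') :=
      hr.comm (cj_mem _ (cl_base s' _) hz) t'
    rw [cj_of_commute hc, cj_cj]
    have hu := hr.comm (cl_gen (x := x) (b := b) (j :: i :: q) s' (r := r)
      (by simp only [List.length_cons]; omega)) t
    simp only [List.map_cons, List.prod_cons] at hu
    rw [← mul_assoc] at hu h
    exact (hu.inv_left.mul_left h).mul_left hu

lemma perm_step (T : Rels a b c x y D L L₂ M R) {r : ℕ} (hr : CC b x y r) (h2 : 2 ≤ r) {l l' : List ιB} (hp : l.Perm l') :
    ∀ p : List ιB, (p ++ l).length = r + 1 →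
    (∀ s t, Commute (cj ((p ++ l').map b).prod (x s)) (y t)) →
    ∀ s t, Commute (cj ((p ++ l).map b).prod (x s)) (y t) := by
  induction hp with
  | nil => intro p _ h; exact h
  | cons i _ ih =>
    intro p hl h
    have := ih (p ++ [i]) (by simpa using hl) (by simpa using h)
    simpa using this
  | swap i j l =>
    intro p hl h
    exact swap_step T hr h2 p l _ _ hl h
  | trans h1 _ ih1 ih2 =>
    intro p hl h
    refine ih1 p hl (ih2 p ?_ h)
    rw [List.length_append, ← h1.length_eq, ← List.length_append, hl]

lemma exists_perm_replicate [Fintype ιB] (l : List ιB)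
    (hl : Fintype.card ιB * M < l.length) :
    ∃ i l', l.Perm (l' ++ List.replicate M i) := by
  classical
  have : ∃ i, M ≤ l.count i := by
    by_contra! hcon
    have h1 : ∑ i, l.count i = l.length := by
      have := Multiset.toFinset_sum_count_eq (l : Multiset ιB)
      simp only [Multiset.coe_count, Multiset.coe_card] at this
      rw [← this]
      symm
      apply Finset.sum_subset (Finset.subset_univ _)
      intro i _ hi
      simpa [List.count_eq_zero] using hi
    have h2 : ∑ i, l.count i ≤ ∑ _i : ιB, M := Finset.sum_le_sum fun i _ => (hcon i).le
    simp at h2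
    omega
  obtain ⟨i, hi⟩ := this
  have hs : (List.replicate M i).Sublist l := List.replicate_sublist_iff.2 hi
  obtain ⟨l', hl'⟩ := hs.exists_perm_append
  exact ⟨i, l', hl'.trans List.perm_append_comm⟩

lemma CC_succ (T : Rels a b c x y D L L₂ M R) [Fintype ιB] {r : ℕ} (hr : CC b x y r) (hD : 1 ≤ D) (hL : D * D + D + 1 ≤ L)
    (hLM : L ≤ M) (hM : D * L₂ + 1 ≤ M) (h2 : 2 ≤ r) (hR : Fintype.card ιB * M ≤ r) :
    CC b x y (r + 1) := by
  intro l s t hl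
  rcases Nat.lt_or_ge l.length (r + 1) with hlt | hge
  · exact hr l s t (by omega)
  have hlen : l.length = r + 1 := le_antisymm hl hge
  obtain ⟨i, l', hp⟩ := exists_perm_replicate (M := M) l (by omega)
  have hlen' : l'.length + M = r + 1 := by
    have := hp.length_eq
    simp at this
    omega
  refine perm_step T hr h2 hp [] (by simpa using hlen) ?_ s t
  clear s t hp hl hlen hge l
  intro s t
  simp only [List.nil_append, List.map_append, List.prod_append, List.map_replicate,
    List.prod_replicate]
  rcases T.htype i with ⟨e, s', t', he0, heM, he⟩ | ⟨j, ⟨s', t', he⟩, hy⟩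
  · -- torsion letter
    have h1 : cj ((l'.map b).prod * b i ^ (M - e)) (x s) ∈ cl x b r := by
      have := cl_gen (x := x) (b := b) (l' ++ List.replicate (M - e) i) s (r := r)
        (by simp; omega)
      simpa using this
    rw [show M = (M - e) + e by omega, pow_add, ← mul_assoc, cj_mul_left, he, cj_mul_left]
    have h3 := cj_mem _ (cl_base (b := b) s' r) h1
    rw [cj_of_commute (hr.comm h3 t')]
    exact hr.comm h3 t
  · -- free letter
    have ha : ∀ p, l'.length + p + L ≤ r + 1 →
        cj (a j) (cj ((l'.map b).prod * b i ^ p) (x s)) ∈ cl x b (l'.length + p + D) := by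
      intro p
      induction p with
      | zero =>
        intro hp
        simp only [pow_zero, mul_one, add_zero]
        refine move (ρ := l'.length) (fun s => T.hxa s j) ?_ (Nat.le_succ _) (cl_gen l' s le_rfl)
        intro i
        obtain ⟨s1, w, hw, hew⟩ := T.hba i j
        exact ⟨s1, w, hew, fun z hz => comm_Y T hr hD (by omega) hz hw⟩
      | succ p ih =>
        intro hp
        have h1 := ih (by omega)
        rw [pow_succ, ← mul_assoc, cj_mul_left]
        rw [← cj_mul_left, he, cj_mul_left, cj_mul_left, cj_mul_left]
        have h4 : cj (x s') (cj (b i) (cj (a j) (cj ((l'.map b).prod * b i ^ p) (x s)))) ∈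
            cl x b (l'.length + (p + 1) + D) :=
          cj_mem _ (cl_base s' _) (cl_mono (by omega) (cl_cj i h1))
        rwa [cj_of_commute (hr.comm (cl_mono (by omega) h4) t')]
    have h1 := ha (M - L) (by omega)
    have h3 := comm_Y T hr hD (ℓ := D) (by omega) h1 (hy t)
    rw [← commute_cj_iff ((b i ^ L)⁻¹ * a j)]
    rw [← cj_mul_left] at h3 ⊢
    convert h3 using 2
    conv_lhs => rw [show M = (M - L) + L by omega, pow_add]
    group

lemma CC_all (T : Rels a b c x y D L L₂ M R) [Fintype ιB] (hD : 1 ≤ D) (hL : D * D + D + 1 ≤ L)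
    (hLM : L ≤ M) (hM : D * L₂ + 1 ≤ M) (h2 : 2 ≤ R) (hR : Fintype.card ιB * M ≤ R) (r : ℕ) :
    CC b x y r := by
  have H : ∀ k, CC b x y (R + k) := by
    intro k
    induction k with
    | zero => exact T.hcom
    | succ k ih => exact CC_succ (r := R + k) T ih hD hL hLM hM (by omega) (by omega)
  intro l s t hl
  exact H r l s t (by omega)

theorem normalClosures_commute (T : Rels a b c x y D L L₂ M R)
    [Fintype ιB] (hD : 1 ≤ D) (hL : D * D + D + 1 ≤ L)
    (hLM : L ≤ M) (hM : D * L₂ + 1 ≤ M) (h2 : 2 ≤ R) (hR : Fintype.card ιB * M ≤ R)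
    (hgen : Subgroup.closure (Set.range a ∪ Set.range b ∪ Set.range c ∪ Set.range x ∪ Set.range y)
      = ⊤)
    {u v : G} (hu : u ∈ Subgroup.normalClosure (Set.range x))
    (hv : v ∈ Subgroup.normalClosure (Set.range y)) : Commute u v := by
  have hC := CC_all T hD hL hLM hM h2 hR
  have hmono : Monotone (cl x b) := fun _ _ h => cl_mono h
  set E : Subgroup G := ⨆ r, cl x b r with hE
  have hmemE : ∀ {z}, z ∈ E ↔ ∃ r, z ∈ cl x b r := by
    intro z
    exact Subgroup.mem_iSup_of_directed hmono.directed_le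
  have hxE : ∀ i, x i ∈ E := fun i => hmemE.2 ⟨0, cl_base i 0⟩
  have hbE : ∀ i, ∀ z ∈ E, cj (b i) z ∈ E := by
    intro i z hz
    obtain ⟨r, hr⟩ := hmemE.1 hz
    exact hmemE.2 ⟨r + 1, cl_cj i hr⟩
  have hYE : ∀ ℓ, ∀ w ∈ cl y (Sum.elim b c) ℓ, ∀ z ∈ E, Commute z w := by
    intro ℓ w hw z hz
    obtain ⟨r, hr⟩ := hmemE.1 hz
    exact comm_Y T (hC (r + D * ℓ)) hD le_rfl hr hw
  have hcE : ∀ i, ∀ z ∈ E, cj (c i) z ∈ E := by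
    intro i z hz
    obtain ⟨r, hr⟩ := hmemE.1 hz
    refine hmemE.2 ⟨r + D, move (ρ := r) (fun s => T.hxc s i) ?_ (Nat.le_succ _) hr⟩
    intro k
    obtain ⟨s, t, he⟩ := T.hbc k i
    exact ⟨s, y t, he, fun z hz => (hC r).comm hz t⟩
  have haE : ∀ i, ∀ z ∈ E, cj (a i) z ∈ E := by
    intro i z hz
    obtain ⟨r, hr⟩ := hmemE.1 hz
    refine hmemE.2 ⟨r + D, move (ρ := r) (fun s => T.hxa s i) ?_ (Nat.le_succ _) hr⟩
    intro k
    obtain ⟨s, w, hw, he⟩ := T.hba k i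
    exact ⟨s, w, he, fun z hz => comm_Y T (hC (r + D * L₂)) hD le_rfl hz hw⟩
  have hyE : ∀ t, ∀ z ∈ E, Commute z (y t) := by
    intro t z hz
    obtain ⟨r, hr⟩ := hmemE.1 hz
    exact (hC r).comm hr t
  -- inverse letters
  have haE' : ∀ i, ∀ z ∈ E, cj (a i)⁻¹ z ∈ E := by
    intro i z hz
    obtain ⟨j, s, w, hw, he⟩ := T.haa i
    have e1 : (a i)⁻¹ = a j * w⁻¹ * (x s)⁻¹ := by
      have : a i = x s * w * (a j)⁻¹ := by rw [← he]; group
      rw [this]; group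
    rw [e1, cj_mul_left, cj_mul_left]
    refine cj_mem _ (E.inv_mem (hxE s)) ?_
    rw [cj_of_commute ((hYE _ w hw _ (haE j z hz)).inv_right)]
    exact haE j z hz
  have hnorm : (⊤ : Subgroup G) ≤ Subgroup.normalizer (E : Set G) := by
    have key : ∀ g : G, (∀ z ∈ E, cj g z ∈ E) → (∀ z ∈ E, cj g⁻¹ z ∈ E) →
        g ∈ Subgroup.normalizer (E : Set G) := by
      intro g h1 h2
      rw [Subgroup.mem_normalizer_iff]
      intro z
      constructor
      · intro hz
        simpa [cj] using h2 z hz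
      · intro hz
        have := h1 _ hz
        simpa [cj, mul_assoc] using this
    rw [← hgen, Subgroup.closure_le]
    rintro g ((((⟨i, rfl⟩ | ⟨i, rfl⟩) | ⟨i, rfl⟩) | ⟨i, rfl⟩) | ⟨i, rfl⟩)
    · exact key _ (haE i) (haE' i)
    · obtain ⟨j, hj⟩ := T.hbinv i
      exact key _ (hbE i) (hj ▸ hbE j)
    · obtain ⟨j, hj⟩ := T.hcinv i
      exact key _ (hcE i) (hj ▸ hcE j)
    · exact key _ (fun z hz => cj_mem _ (hxE i) hz)
        (fun z hz => cj_mem _ (E.inv_mem (hxE i)) hz)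
    · exact key _ (fun z hz => by rwa [cj_of_commute (hyE i z hz)])
        (fun z hz => by rwa [cj_of_commute (hyE i z hz).inv_right])
  have hEn : E.Normal := Subgroup.normalizer_eq_top_iff.1 (top_le_iff.1 hnorm)
  have huE : u ∈ E := by
    have : Subgroup.normalClosure (Set.range x) ≤ E :=
      Subgroup.normalClosure_le_normal (by rintro _ ⟨i, rfl⟩; exact hxE i)
    exact this hu
  have hcent : (Subgroup.centralizer (E : Set G)).Normal := inferInstance
  have hvE : v ∈ Subgroup.centralizer (E : Set G) := by
    have : Subgroup.normalClosure (Set.range y) ≤ Subgroup.centralizer (E : Set G) :=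
      Subgroup.normalClosure_le_normal (by
        rintro _ ⟨i, rfl⟩
        exact Subgroup.mem_centralizer_iff.2 fun z hz => (hyE i z hz).eq)
    exact this hv
  exact Subgroup.mem_centralizer_iff.1 hvE u huE

end Comm

end FibreFP

/-! ### Part 2: finite generation modulo `[R₁, R₂]` -/

namespace FibreFP

section Noeth
variable {E : Type*} [Group E]

theorem noeth [Group.FG E] (B : Subgroup E) [B.Normal]
    (hB : B ≤ Subgroup.centralizer (B : Set E))
    (hc : commutator E ≤ Subgroup.centralizer (B : Set E))
    (hfg : B.IsFinitelyNormallyGenerated) (J : Subgroup E) [hJ : J.Normal] (hJB : J ≤ B) :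
    J.IsFinitelyNormallyGenerated := by
  let : CommGroup B := { (inferInstance : Group B) with
    mul_comm := fun a b => Subtype.ext (Subgroup.mem_centralizer_iff.1 (hB b.2) a a.2) }
  let A := Additive B
  let toEnd : MulAut B →* Module.End ℤ A :=
    { toFun := fun f => (MonoidHom.toAdditive (f : B →* B)).toIntLinearMap
      map_one' := by ext; rfl
      map_mul' := by intro f g; ext; rfl }
  let Q := Abelianization E
  let ρ : Q →* Module.End ℤ A := toEnd.comp (QuotientGroup.lift (commutator E)
    (MulAut.conjNormal (H := B)) (by
      intro e he
      ext b
      have := Subgroup.mem_centralizer_iff.1 (hc he) b b.2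
      rw [MulAut.conjNormal_apply, ← this]
      simp))
  have hρ : ∀ (e : E) (a : A), ((ρ (Abelianization.of e) a).toMul : E) = e * a.toMul * e⁻¹ := by
    intro e a
    rfl
  have : Group.FG Q := Group.fg_of_surjective (f := (Abelianization.of : E →* Q)) (QuotientGroup.mk'_surjective _)
  have : Monoid.FG Q := inferInstance
  let Λ := MonoidAlgebra ℤ Q
  have : Algebra.FiniteType ℤ Λ := inferInstance
  have : IsNoetherianRing Λ := Algebra.FiniteType.isNoetherianRing ℤ Λ
  let : Module Λ A := Module.compHom A (MonoidAlgebra.lift ℤ (Module.End ℤ A) Q ρ).toRingHom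
  have hsm : ∀ (r : Λ) (a : A), r • a = (MonoidAlgebra.lift ℤ (Module.End ℤ A) Q ρ) r a :=
    fun _ _ => rfl
  have hsm1 : ∀ (e : E) (a : A), (MonoidAlgebra.of ℤ Q (Abelianization.of e) : Λ) • a
      = ρ (Abelianization.of e) a := by
    intro e a
    rw [hsm, MonoidAlgebra.lift_of]
  have hsurj : ∀ q : Q, ∃ e : E, Abelianization.of e = q :=
    fun q => QuotientGroup.mk_surjective q
  -- submodule attached to a normal subgroup
  let toSub : ∀ (J : Subgroup E) (_ : J.Normal), Submodule Λ A := fun J hJ =>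
    { carrier := {a | (a.toMul : E) ∈ J}
      add_mem' := fun {a b} ha hb => J.mul_mem ha hb
      zero_mem' := J.one_mem
      smul_mem' := by
        intro r a ha
        induction r using MonoidAlgebra.induction_on with
        | of q =>
          obtain ⟨e, rfl⟩ := hsurj q
          rw [hsm1]
          show ((ρ (Abelianization.of e) a).toMul : E) ∈ J
          rw [hρ]
          exact hJ.conj_mem _ ha e
        | add f g hf hg => rw [add_smul]; exact J.mul_mem hf hg
        | smul r f hf =>
          rw [smul_assoc]
          exact J.zpow_mem hf r }
  have hfin : Module.Finite Λ A := by
    obtain ⟨S, hSf, hS⟩ := hfg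
    let S' : Set A := {a | (a.toMul : E) ∈ S}
    have hS'f : S'.Finite := hSf.preimage (by
      intro a _ b _ h
      exact Additive.toMul.injective (Subtype.ext h))
    refine ⟨⟨hS'f.toFinset, ?_⟩⟩
    rw [Set.Finite.coe_toFinset]
    let P := Submodule.span Λ S'
    let PS : Subgroup E :=
      { carrier := {e | ∃ h : e ∈ B, (Additive.ofMul ⟨e, h⟩ : A) ∈ P}
        mul_mem' := by
          rintro a b ⟨ha, ha'⟩ ⟨hb, hb'⟩
          exact ⟨B.mul_mem ha hb, P.add_mem ha' hb'⟩
        one_mem' := ⟨B.one_mem, P.zero_mem⟩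
        inv_mem' := by
          rintro a ⟨ha, ha'⟩
          exact ⟨B.inv_mem ha, P.neg_mem ha'⟩ }
    have hPS : PS.Normal := by
      constructor
      rintro n ⟨hn, hn'⟩ g
      refine ⟨Subgroup.Normal.conj_mem inferInstance n hn g, ?_⟩
      have := P.smul_mem (MonoidAlgebra.of ℤ Q (Abelianization.of g) : Λ) hn'
      rw [hsm1] at this
      exact this
    have hle : B ≤ PS := by
      rw [← hS]
      refine Subgroup.normalClosure_le_normal ?_
      intro s hs
      have hsB : s ∈ B := hS ▸ Subgroup.subset_normalClosure hs
      exact ⟨hsB, Submodule.subset_span hs⟩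
    rw [eq_top_iff]
    intro a _
    obtain ⟨_, h⟩ := hle a.toMul.2
    exact h
  have : IsNoetherian Λ A := isNoetherian_of_isNoetherianRing_of_finite Λ A
  obtain ⟨s, hs⟩ := IsNoetherian.noetherian (toSub J hJ)
  refine ⟨(fun a : A => (a.toMul : E)) '' (s : Set A), s.finite_toSet.image _, ?_⟩
  apply le_antisymm
  · refine Subgroup.normalClosure_le_normal ?_
    rintro _ ⟨a, ha, rfl⟩
    have : a ∈ toSub J hJ := hs ▸ Submodule.subset_span ha
    exact this
  · intro j hj
    have h1 : toSub J hJ ≤ toSub (Subgroup.normalClosure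
        ((fun a : A => (a.toMul : E)) '' (s : Set A))) inferInstance := by
      rw [← hs, Submodule.span_le]
      intro a ha
      exact Subgroup.subset_normalClosure ⟨a, ha, rfl⟩
    have h2 : (Additive.ofMul ⟨j, hJB hj⟩ : A) ∈ toSub J hJ := hj
    exact h1 h2

/-- relative version -/
theorem noeth' {F : Type*} [Group F] [Group.FG F] (R' R : Subgroup F) [R'.Normal] [R.Normal]
    (hle : R' ≤ R) (hc : commutator F ≤ R) (hfg : R'.IsFinitelyNormallyGenerated)
    (J : Subgroup F) [hJ : J.Normal] (hJR : J ≤ R') :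
    ∃ S : Set F, S.Finite ∧ S ⊆ J ∧ J ≤ Subgroup.normalClosure S ⊔ ⁅R', R⁆ := by
  let π := QuotientGroup.mk' ⁅R', R⁆
  have hπ : Function.Surjective π := QuotientGroup.mk'_surjective _
  have hcen : R.map π ≤ Subgroup.centralizer ((R'.map π : Subgroup _) : Set (F ⧸ ⁅R', R⁆)) := by
    rw [Subgroup.le_centralizer_iff, ← Subgroup.commutator_eq_bot_iff_le_centralizer,
      ← Subgroup.map_commutator, eq_bot_iff, Subgroup.map_le_iff_le_comap]
    intro z hz
    simpa [π] using hz
  have : (R'.map π).Normal := Subgroup.Normal.map inferInstance π hπ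
  have : (J.map π).Normal := Subgroup.Normal.map inferInstance π hπ
  have := noeth (R'.map π) ((Subgroup.map_mono hle).trans hcen)
    (le_trans (by
      rw [commutator_def, ← Subgroup.map_top_of_surjective π hπ, ← Subgroup.map_commutator]
      exact Subgroup.map_mono hc) hcen) (hfg.map hπ) (J.map π) (Subgroup.map_mono hJR)
  obtain ⟨S, hSf, hS⟩ := this
  have hSJ : S ⊆ π '' J := by
    have : S ⊆ (J.map π : Subgroup _) := hS ▸ Subgroup.subset_normalClosure
    simpa using this
  obtain ⟨S', hS'J, hS'f, rfl⟩ : ∃ S' : Set F, S' ⊆ J ∧ S'.Finite ∧ π '' S' = S := by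
    classical
    lift S to Finset (F ⧸ ⁅R', R⁆) using hSf
    obtain ⟨u, hu, rfl⟩ := Finset.subset_set_image_iff.1 hSJ
    exact ⟨u, hu, u.finite_toSet, by simp⟩
  refine ⟨S', hS'f, hS'J, ?_⟩
  intro j hj
  have h1 : π j ∈ (Subgroup.normalClosure S').map π := by
    rw [Subgroup.map_normalClosure _ _ hπ, hS]
    exact ⟨j, hj, rfl⟩
  obtain ⟨n, hn, hnj⟩ := h1
  have : n⁻¹ * j ∈ ⁅R', R⁆ := QuotientGroup.eq.1 hnj
  have h3 := Subgroup.mul_mem_sup hn this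
  simpa using h3

end Noeth
end FibreFP

namespace FibreFP

section Hopf
open scoped commutatorElement
variable {F : Type*} [Group F]

theorem hopf_step [IsFreeGroup F] (R₁ R₂ : Subgroup F) [R₁.Normal] [R₂.Normal] :
    ⁅R₁, R₁⁆ ⊓ ⁅R₂, R₁ ⊔ R₂⁆ ≤ ⁅R₁, R₂⁆ := by
  let R := R₁ ⊔ R₂
  let π := QuotientGroup.mk' ⁅R₁, R₂⁆
  have hπ : Function.Surjective π := QuotientGroup.mk'_surjective _
  have hcomm : ∀ a ∈ R₁.map π, ∀ b ∈ R₂.map π, Commute a b := by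
    rintro _ ⟨a, ha, rfl⟩ _ ⟨b, hb, rfl⟩
    show π a * π b = π b * π a
    rw [← map_mul, ← map_mul]
    refine QuotientGroup.eq.2 ?_
    have h := Subgroup.commutator_mem_commutator (R₂.inv_mem hb) (R₁.inv_mem ha)
    rw [Subgroup.commutator_comm, commutatorElement_def] at h
    simpa [mul_assoc] using h
  have hn1 : (R₁.map π).Normal := Subgroup.Normal.map inferInstance π hπ
  have hn2 : (R₂.map π).Normal := Subgroup.Normal.map inferInstance π hπ
  have hdec : ∀ g : R, ∃ r₁ ∈ R₁, ∃ r₂ ∈ R₂, r₁ * r₂ = (g : F) :=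
    fun g => Subgroup.mem_sup_of_normal_left.1 g.2
  choose d hd1 d2 hd2 hd using hdec
  let ρ : R →* F ⧸ ⁅R₁, R₂⁆ :=
    IsFreeGroup.lift (fun i => π (d (IsFreeGroup.of i)))
  have hρ : ∀ i, ρ (IsFreeGroup.of i) = π (d (IsFreeGroup.of i)) := fun i =>
    IsFreeGroup.lift_of _ _
  have h1 : ∀ r, ρ r ∈ R₁.map π := by
    have : (QuotientGroup.mk' (R₁.map π)).comp ρ = 1 := by
      apply IsFreeGroup.ext_hom
      intro i
      simp only [MonoidHom.comp_apply, hρ, MonoidHom.one_apply]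
      exact (QuotientGroup.eq_one_iff _).2 ⟨_, hd1 _, rfl⟩
    intro r
    exact (QuotientGroup.eq_one_iff _).1 (DFunLike.congr_fun this r)
  have h2 : ∀ r : R, (ρ r)⁻¹ * π r ∈ R₂.map π := by
    have : (QuotientGroup.mk' (R₂.map π)).comp ρ =
        (QuotientGroup.mk' (R₂.map π)).comp (π.comp R.subtype) := by
      apply IsFreeGroup.ext_hom
      intro i
      simp only [MonoidHom.comp_apply, hρ]
      refine QuotientGroup.eq.2 ⟨d2 (IsFreeGroup.of i), hd2 _, ?_⟩
      have := hd (IsFreeGroup.of i)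
      rw [Subgroup.subtype_apply, ← this, map_mul, inv_mul_cancel_left]
    intro r
    exact QuotientGroup.eq.1 (DFunLike.congr_fun this r)
  have hA : ⁅R₁, R₁⁆ ≤ (MonoidHom.eqLocus ρ (π.comp R.subtype)).map R.subtype := by
    rw [Subgroup.commutator_le]
    intro u hu v hv
    have huR : u ∈ R := Subgroup.mem_sup_left hu
    have hvR : v ∈ R := Subgroup.mem_sup_left hv
    refine ⟨⁅(⟨u, huR⟩ : R), (⟨v, hvR⟩ : R)⁆, ?_, by simp [commutatorElement_def]⟩
    show ρ _ = π _
    have key : ∀ (w : F) (hw : w ∈ R₁) (hwR : w ∈ R), ∃ z, π w = ρ ⟨w, hwR⟩ * z ∧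
        (∀ a ∈ R₁.map π, Commute a z) ∧ z ∈ R₁.map π := by
      intro w hw hwR
      refine ⟨(ρ ⟨w, hwR⟩)⁻¹ * π w, by group, fun a ha => hcomm a ha _ (h2 ⟨w, hwR⟩), ?_⟩
      exact Subgroup.mul_mem _ (Subgroup.inv_mem _ (h1 _)) ⟨w, hw, rfl⟩
    obtain ⟨z, hz, hz1, hz2⟩ := key u hu huR
    obtain ⟨z', hz', hz1', hz2'⟩ := key v hv hvR
    simp only [commutatorElement_def, map_mul, map_inv, Subgroup.subtype_apply]
    rw [hz, hz']
    have hvm := h1 ⟨v, hvR⟩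
    have hum := h1 ⟨u, huR⟩
    set U := ρ ⟨u, huR⟩
    set V := ρ ⟨v, hvR⟩
    have c1 := (hz1 V hvm).eq
    have c2 := (hz1' U hum).eq
    have c3 := (hz1 z' hz2').eq
    have e1 : U * z * (V * z') = U * V * z * z' := by
      rw [mul_assoc, ← mul_assoc z, ← c1]; simp only [mul_assoc]
    have e2 : V * z' * (U * z) = V * U * z * z' := by
      rw [mul_assoc, ← mul_assoc z', ← c2, mul_assoc U, c3]; simp only [mul_assoc]
    have : U * z * (V * z') * (U * z)⁻¹ * (V * z')⁻¹
        = (U * z * (V * z')) * (V * z' * (U * z))⁻¹ := by group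
    rw [this, e1, e2]
    group
  have hB : ⁅R₂, R⁆ ≤ ρ.ker.map R.subtype := by
    rw [Subgroup.commutator_le]
    intro u hu v hvR
    have huR : u ∈ R := Subgroup.mem_sup_right hu
    refine ⟨⁅(⟨u, huR⟩ : R), (⟨v, hvR⟩ : R)⁆, ?_, by simp [commutatorElement_def]⟩
    show ρ _ = 1
    rw [map_commutatorElement, commutatorElement_eq_one_iff_commute]
    refine (hcomm _ (h1 _) _ ?_).symm
    have h3 := h2 ⟨u, huR⟩
    have h4 : π u ∈ R₂.map π := ⟨u, hu, rfl⟩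
    have h5 := Subgroup.mul_mem _ h4 (Subgroup.inv_mem _ h3)
    simpa using h5
  rintro c ⟨hc1, hc2⟩
  obtain ⟨r, hr, rfl⟩ := hA hc1
  obtain ⟨r', hr', he⟩ := hB hc2
  have : r' = r := Subtype.ext he
  subst this
  have hr : ρ r' = π r' := hr
  have hr' : ρ r' = 1 := hr'
  rw [hr'] at hr
  exact (QuotientGroup.eq_one_iff _).1 hr.symm

theorem thmA [IsFreeGroup F] [Group.FG F] (R₁ R₂ : Subgroup F) [R₁.Normal] [R₂.Normal]
    (h₁ : R₁.IsFinitelyNormallyGenerated) (h₂ : R₂.IsFinitelyNormallyGenerated)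
    (hc : commutator F ≤ R₁ ⊔ R₂) {S : Set F} (hSf : S.Finite) (hS : S ⊆ (R₁ ⊓ R₂ : Subgroup F))
    (hR : ⁅R₁, R₂⁆ ≤ Subgroup.normalClosure S) : (R₁ ⊓ R₂).IsFinitelyNormallyGenerated := by
  obtain ⟨S₁, hf₁, hs₁, hl₁⟩ := noeth' R₁ (R₁ ⊔ R₂) le_sup_left hc h₁ (R₁ ⊓ R₂) inf_le_left
  obtain ⟨S₂, hf₂, hs₂, hl₂⟩ := noeth' R₂ (R₁ ⊔ R₂) le_sup_right hc h₂ (⁅R₁, R₁⁆ ⊓ R₂) inf_le_right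
  have h11 : ⁅R₁, R₁⁆ ≤ R₁ := Subgroup.commutator_le_left _ _
  have h12 : ⁅R₁, R₂⁆ ≤ R₁ ⊓ R₂ := Subgroup.commutator_le_inf _ _
  have hU : S ∪ S₁ ∪ S₂ ⊆ (R₁ ⊓ R₂ : Subgroup F) := by
    refine Set.union_subset (Set.union_subset hS hs₁) (hs₂.trans ?_)
    exact inf_le_inf_right R₂ h11
  refine ⟨S ∪ S₁ ∪ S₂, (hSf.union hf₁).union hf₂, le_antisymm
    (Subgroup.normalClosure_le_normal hU) ?_⟩
  set N := Subgroup.normalClosure (S ∪ S₁ ∪ S₂) with hN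
  have hNle : N ≤ R₁ ⊓ R₂ := Subgroup.normalClosure_le_normal hU
  have n1 : Subgroup.normalClosure S₁ ≤ N := Subgroup.normalClosure_mono (by grind)
  have n2 : Subgroup.normalClosure S₂ ≤ N := Subgroup.normalClosure_mono (by grind)
  have n0 : ⁅R₁, R₂⁆ ≤ N := hR.trans (Subgroup.normalClosure_mono (by grind))
  -- commutators of `R₁` inside `R₂`
  have key : ⁅R₁, R₁⁆ ⊓ R₂ ≤ N := by
    intro z hz
    obtain ⟨n, hn, w, hw, rfl⟩ := Subgroup.mem_sup_of_normal_left.1 (hl₂ hz)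
    refine N.mul_mem (n2 hn) (n0 (hopf_step R₁ R₂ ⟨?_, hw⟩))
    have hn' : n ∈ ⁅R₁, R₁⁆ ⊓ R₂ := Subgroup.normalClosure_le_normal hs₂ hn
    have := Subgroup.mul_mem _ (Subgroup.inv_mem _ hn'.1) hz.1
    simpa using this
  intro z hz
  obtain ⟨n, hn, w, hw, rfl⟩ := Subgroup.mem_sup_of_normal_left.1 (hl₁ hz)
  refine N.mul_mem (n1 hn) ?_
  have hw2 : w ∈ R₂ := by
    have := Subgroup.mul_mem _ (Subgroup.inv_mem _ (hNle (n1 hn)).2) hz.2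
    simpa using this
  have hsup : ⁅R₁, R₁ ⊔ R₂⁆ ≤ ⁅R₁, R₁⁆ ⊔ ⁅R₁, R₂⁆ := by
    rw [Subgroup.commutator_le]
    intro u hu v hv
    obtain ⟨a, ha, b, hb, rfl⟩ := Subgroup.mem_sup_of_normal_left.1 hv
    have e : ⁅u, a * b⁆ = ⁅u, a⁆ * (a * ⁅u, b⁆ * a⁻¹) := by
      simp only [commutatorElement_def]; group
    rw [e]
    refine Subgroup.mul_mem_sup (Subgroup.commutator_mem_commutator hu ha) ?_
    exact Subgroup.Normal.conj_mem inferInstance _ (Subgroup.commutator_mem_commutator hu hb) a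
  obtain ⟨p, hp, q, hq, rfl⟩ := Subgroup.mem_sup_of_normal_left.1 (hsup hw)
  refine N.mul_mem (key ⟨hp, ?_⟩) (n0 hq)
  have := Subgroup.mul_mem _ hw2 (Subgroup.inv_mem _ (h12 hq).2)
  simpa using this

end Hopf
end FibreFP

/-! ### Part 3: the finite presentability criterion -/

namespace FibreFP

section FP

theorem ker_fng_of_fp {E G : Type*} [Group E] [Group G] [Group.FG E]
    [hG : Group.IsFinitelyPresented G] (f : E →* G) (hf : Function.Surjective f) :
    f.ker.IsFinitelyNormallyGenerated := by
  obtain ⟨n, φ, hφ, S, hSf, hS⟩ := hG.out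
  choose g hg using fun i => hf (φ (FreeGroup.of i))
  let ψ : FreeGroup (Fin n) →* E := FreeGroup.lift g
  have hψ : ∀ w, f (ψ w) = φ w := by
    have : f.comp ψ = φ := by
      apply FreeGroup.ext_hom
      intro i
      simp [ψ, hg]
    intro w
    exact DFunLike.congr_fun this w
  obtain ⟨T, hT⟩ := Group.fg_iff.1 (inferInstance : Group.FG E)
  choose w hw using fun e => hφ (f e)
  refine ⟨ψ '' S ∪ (fun e => e⁻¹ * ψ (w e)) '' T, (hSf.image _).union (hT.2.image _), ?_⟩
  set N := Subgroup.normalClosure (ψ '' S ∪ (fun e => e⁻¹ * ψ (w e)) '' T) with hN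
  apply le_antisymm
  · refine Subgroup.normalClosure_le_normal ?_
    rintro _ (⟨s, hs, rfl⟩ | ⟨e, he, rfl⟩)
    · have : s ∈ φ.ker := hS ▸ Subgroup.subset_normalClosure hs
      simpa [hψ, MonoidHom.mem_ker] using this
    · simp [MonoidHom.mem_ker, hψ, hw]
  · have htop : ψ.range ⊔ N = ⊤ := by
      rw [eq_top_iff, ← hT.1, Subgroup.closure_le]
      intro e he
      have h1 : e⁻¹ * ψ (w e) ∈ N := Subgroup.subset_normalClosure (Or.inr ⟨e, he, rfl⟩)
      have h2 : ψ (w e) ∈ ψ.range := ⟨w e, rfl⟩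
      have := Subgroup.mul_mem_sup h2 (N.inv_mem h1)
      simpa using this
    have hker : φ.ker ≤ N.comap ψ := by
      rw [← hS]
      refine Subgroup.normalClosure_le_normal ?_
      intro s hs
      exact Subgroup.subset_normalClosure (Or.inl ⟨s, hs, rfl⟩)
    intro e he
    have h1 : e ∈ ψ.range ⊔ N := htop ▸ Subgroup.mem_top e
    obtain ⟨_, ⟨v, rfl⟩, m, hm, rfl⟩ := Subgroup.mem_sup_of_normal_right.1 h1
    have hm' : f m = 1 := by
      have : N ≤ f.ker := by
        refine Subgroup.normalClosure_le_normal ?_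
        rintro _ (⟨s, hs, rfl⟩ | ⟨e, he, rfl⟩)
        · have : s ∈ φ.ker := hS ▸ Subgroup.subset_normalClosure hs
          simpa [hψ, MonoidHom.mem_ker] using this
        · simp [MonoidHom.mem_ker, hψ, hw]
      exact this hm
    have hv : v ∈ φ.ker := by
      have h3 : f (ψ v * m) = 1 := he
      rw [map_mul, hm', mul_one, hψ] at h3
      exact h3
    exact N.mul_mem (hker hv) hm

variable {F H : Type*} [Group F] [Group H] (p : F →* H)

/-- normal closure of a finite set of relators -/
def relN (S : Finset p.ker) : Subgroup F := Subgroup.normalClosure ((↑) '' (S : Set p.ker))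

instance (S : Finset p.ker) : (relN p S).Normal := Subgroup.normalClosure_normal

open Filter

variable {p}

lemma ev_eq {u v : F} (h : p u = p v) :
    ∀ᶠ S : Finset p.ker in atTop, QuotientGroup.mk' (relN p S) u = QuotientGroup.mk' (relN p S) v := by
  have hk : u⁻¹ * v ∈ p.ker := by simp [MonoidHom.mem_ker, h]
  filter_upwards [eventually_ge_atTop ({⟨_, hk⟩} : Finset p.ker)] with S hS
  refine QuotientGroup.eq.2 (Subgroup.subset_normalClosure ⟨⟨_, hk⟩, ?_, rfl⟩)
  exact hS (Finset.mem_singleton_self _)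

lemma ev_cl {ι κ : Type*} {x : ι → F} {b : κ → F} {r : ℕ} {u : F}
    (h : p u ∈ cl (p ∘ x) (p ∘ b) r) : ∀ᶠ S : Finset p.ker in atTop,
      QuotientGroup.mk' (relN p S) u ∈
        cl (QuotientGroup.mk' (relN p S) ∘ x) (QuotientGroup.mk' (relN p S) ∘ b) r := by
  rw [← map_cl] at h
  obtain ⟨w, hw, he⟩ := h
  filter_upwards [ev_eq he] with S hS
  rw [← hS, ← map_cl]
  exact ⟨w, hw, rfl⟩

lemma ev_nc (hp : Function.Surjective p) {ι : Type*} {x : ι → F} {u : F}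
    (h : p u ∈ Subgroup.normalClosure (Set.range (p ∘ x))) : ∀ᶠ S : Finset p.ker in atTop,
      QuotientGroup.mk' (relN p S) u ∈
        Subgroup.normalClosure (Set.range (QuotientGroup.mk' (relN p S) ∘ x)) := by
  rw [Set.range_comp, ← Subgroup.map_normalClosure _ _ hp] at h
  obtain ⟨w, hw, he⟩ := h
  filter_upwards [ev_eq he] with S hS
  rw [← hS, Set.range_comp, ← Subgroup.map_normalClosure _ _ (QuotientGroup.mk'_surjective _)]
  exact ⟨w, hw, rfl⟩

variable {ιA ιB ιC ιX ιY : Type*} [Finite ιA] [Finite ιB] [Finite ιC] [Finite ιX] [Finite ιY]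
  {a : ιA → F} {b : ιB → F} {c : ιC → F} {x : ιX → F} {y : ιY → F} {D L L₂ M R : ℕ}

lemma ev_Rels (T : Rels (p ∘ a) (p ∘ b) (p ∘ c) (p ∘ x) (p ∘ y) D L L₂ M R) :
    ∀ᶠ S : Finset p.ker in atTop,
      Rels (QuotientGroup.mk' (relN p S) ∘ a) (QuotientGroup.mk' (relN p S) ∘ b)
        (QuotientGroup.mk' (relN p S) ∘ c) (QuotientGroup.mk' (relN p S) ∘ x)
        (QuotientGroup.mk' (relN p S) ∘ y) D L L₂ M R := by
  have hbb : ∀ᶠ S : Finset p.ker in atTop, ∀ i j, ∃ s t, QuotientGroup.mk' (relN p S) (b i * b j)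
      = QuotientGroup.mk' (relN p S) (x s * y t * (b j * b i)) := by
    simp only [eventually_all]
    intro i j
    obtain ⟨s, t, h⟩ := T.hbb i j
    filter_upwards [ev_eq (p := p) (u := b i * b j) (v := x s * y t * (b j * b i))
      (by simpa using h)] with S hS using ⟨s, t, hS⟩
  have hbb' : ∀ᶠ S : Finset p.ker in atTop, ∀ i j, ∃ s t, QuotientGroup.mk' (relN p S) (b i * b j)
      = QuotientGroup.mk' (relN p S) (b j * b i * (x s * y t)) := by
    simp only [eventually_all]
    intro i j
    obtain ⟨s, t, h⟩ := T.hbb' i j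
    filter_upwards [ev_eq (p := p) (u := b i * b j) (v := b j * b i * (x s * y t))
      (by simpa using h)] with S hS using ⟨s, t, hS⟩
  have hbinv : ∀ᶠ S : Finset p.ker in atTop, ∀ i, ∃ j, QuotientGroup.mk' (relN p S) (b j)
      = QuotientGroup.mk' (relN p S) (b i)⁻¹ := by
    simp only [eventually_all]
    intro i
    obtain ⟨j, h⟩ := T.hbinv i
    filter_upwards [ev_eq (p := p) (u := b j) (v := (b i)⁻¹)
      (by simpa using h)] with S hS using ⟨j, hS⟩
  have hcinv : ∀ᶠ S : Finset p.ker in atTop, ∀ i, ∃ j, QuotientGroup.mk' (relN p S) (c j)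
      = QuotientGroup.mk' (relN p S) (c i)⁻¹ := by
    simp only [eventually_all]
    intro i
    obtain ⟨j, h⟩ := T.hcinv i
    filter_upwards [ev_eq (p := p) (u := c j) (v := (c i)⁻¹)
      (by simpa using h)] with S hS using ⟨j, hS⟩
  have hba : ∀ᶠ S : Finset p.ker in atTop, ∀ i j, ∃ s, ∃ w ∈ cl y (Sum.elim b c) L₂,
      QuotientGroup.mk' (relN p S) (b i * a j)
        = QuotientGroup.mk' (relN p S) (x s * w * (a j * b i)) := by
    simp only [eventually_all]
    intro i j
    obtain ⟨s, w, hw, h⟩ := T.hba i j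
    rw [← Sum.comp_elim, ← map_cl] at hw
    obtain ⟨w', hw', rfl⟩ := hw
    filter_upwards [ev_eq (p := p) (u := b i * a j) (v := x s * w' * (a j * b i))
      (by simpa using h)] with S hS using ⟨s, w', hw', hS⟩
  have hbc : ∀ᶠ S : Finset p.ker in atTop, ∀ i j, ∃ s t, QuotientGroup.mk' (relN p S) (b i * c j)
      = QuotientGroup.mk' (relN p S) (x s * y t * (c j * b i)) := by
    simp only [eventually_all]
    intro i j
    obtain ⟨s, t, h⟩ := T.hbc i j
    filter_upwards [ev_eq (p := p) (u := b i * c j) (v := x s * y t * (c j * b i))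
      (by simpa using h)] with S hS using ⟨s, t, hS⟩
  have hxa : ∀ᶠ S : Finset p.ker in atTop, ∀ i j, QuotientGroup.mk' (relN p S) (cj (a j) (x i)) ∈
      cl (QuotientGroup.mk' (relN p S) ∘ x) (QuotientGroup.mk' (relN p S) ∘ b) D := by
    simp only [eventually_all]
    intro i j
    exact ev_cl (by simpa [map_cj] using T.hxa i j)
  have hxc : ∀ᶠ S : Finset p.ker in atTop, ∀ i j, QuotientGroup.mk' (relN p S) (cj (c j) (x i)) ∈
      cl (QuotientGroup.mk' (relN p S) ∘ x) (QuotientGroup.mk' (relN p S) ∘ b) D := by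
    simp only [eventually_all]
    intro i j
    exact ev_cl (by simpa [map_cj] using T.hxc i j)
  have htype : ∀ᶠ S : Finset p.ker in atTop, ∀ i,
      (∃ e s t, 0 < e ∧ e ≤ M ∧ QuotientGroup.mk' (relN p S) (b i ^ e) =
        QuotientGroup.mk' (relN p S) (x s * y t)) ∨
      ∃ j, (∃ s t, QuotientGroup.mk' (relN p S) (b i * a j)
        = QuotientGroup.mk' (relN p S) (a j * b i * (x s * y t))) ∧
        ∀ t, QuotientGroup.mk' (relN p S) (cj ((b i ^ L)⁻¹ * a j) (y t)) ∈
          cl (QuotientGroup.mk' (relN p S) ∘ y)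
            (QuotientGroup.mk' (relN p S) ∘ Sum.elim b c) D := by
    simp only [eventually_all]
    intro i
    rcases T.htype i with ⟨e, s, t, h1, h2, h⟩ | ⟨j, ⟨s, t, h⟩, h2⟩
    · filter_upwards [ev_eq (p := p) (u := b i ^ e) (v := x s * y t)
        (by simpa using h)] with S hS using Or.inl ⟨e, s, t, h1, h2, hS⟩
    · have h3 : ∀ᶠ S : Finset p.ker in atTop, ∀ t, QuotientGroup.mk' (relN p S)
          (cj ((b i ^ L)⁻¹ * a j) (y t)) ∈ cl (QuotientGroup.mk' (relN p S) ∘ y)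
            (QuotientGroup.mk' (relN p S) ∘ Sum.elim b c) D := by
        simp only [eventually_all]
        intro t
        refine ev_cl ?_
        rw [Sum.comp_elim]
        simpa [map_cj] using h2 t
      filter_upwards [h3, ev_eq (p := p) (u := b i * a j) (v := a j * b i * (x s * y t))
        (by simpa using h)] with S hS hS' using Or.inr ⟨j, ⟨s, t, hS'⟩, hS⟩
  have haa : ∀ᶠ S : Finset p.ker in atTop, ∀ j, ∃ j' s, ∃ w ∈ cl y (Sum.elim b c) L₂,
      QuotientGroup.mk' (relN p S) (a j * a j') = QuotientGroup.mk' (relN p S) (x s * w) := by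
    simp only [eventually_all]
    intro j
    obtain ⟨j', s, w, hw, h⟩ := T.haa j
    rw [← Sum.comp_elim, ← map_cl] at hw
    obtain ⟨w', hw', rfl⟩ := hw
    filter_upwards [ev_eq (p := p) (u := a j * a j') (v := x s * w')
      (by simpa using h)] with S hS using ⟨j', s, w', hw', hS⟩
  have hcom : ∀ᶠ S : Finset p.ker in atTop, ∀ l ∈ {l : List ιB | l.length ≤ R}, ∀ s t,
      QuotientGroup.mk' (relN p S) (cj (l.map b).prod (x s) * y t) =
      QuotientGroup.mk' (relN p S) (y t * cj (l.map b).prod (x s)) := by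
    rw [eventually_all_finite (List.finite_length_le ιB R)]
    intro l hl
    simp only [eventually_all]
    intro s t
    refine ev_eq ?_
    have := (T.hcom l s t hl).eq
    simpa [map_cj, map_list_prod] using this
  filter_upwards [hbb, hbb', hbinv, hcinv, hba, hbc, hxa, hxc, htype, haa, hcom] with
    S hbb hbb' hbinv hcinv hba hbc hxa hxc htype haa hcom
  set π := QuotientGroup.mk' (relN p S) with hπ
  have hw : ∀ {w}, w ∈ cl y (Sum.elim b c) L₂ → π w ∈ cl (π ∘ y) (Sum.elim (π ∘ b) (π ∘ c)) L₂ := by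
    intro w hw
    rw [← Sum.comp_elim, ← map_cl]
    exact ⟨w, hw, rfl⟩
  refine ⟨?_, ?_, ?_, ?_, ?_, ?_, ?_, ?_, ?_, ?_, ?_⟩
  · simpa only [Function.comp_apply, map_mul] using hbb
  · simpa only [Function.comp_apply, map_mul] using hbb'
  · simpa only [Function.comp_apply, map_inv] using hbinv
  · simpa only [Function.comp_apply, map_inv] using hcinv
  · intro i j
    obtain ⟨s, w, hw1, h⟩ := hba i j
    exact ⟨s, π w, hw hw1, by simpa only [Function.comp_apply, map_mul] using h⟩
  · simpa only [Function.comp_apply, map_mul] using hbc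
  · simpa only [Function.comp_apply, map_cj] using hxa
  · simpa only [Function.comp_apply, map_cj] using hxc
  · simpa only [Function.comp_apply, map_mul, map_pow, map_cj, map_inv, Sum.comp_elim] using htype
  · intro j
    obtain ⟨j', s, w, hw1, h⟩ := haa j
    exact ⟨j', s, π w, hw hw1, by simpa only [Function.comp_apply, map_mul] using h⟩
  · intro l s t hl
    have := hcom l hl s t
    simp only [map_mul, map_cj, map_list_prod, List.map_map] at this
    exact this

end FP

section ThmB
open Filter
open scoped commutatorElement

theorem thmB' {F H G₁ G₂ : Type*} [Group F] [IsFreeGroup F] [Group.FG F]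
    [hFfp : Group.IsFinitelyPresented F] [Group H] [Group G₁] [Group G₂]
    [Group.IsFinitelyPresented G₁] [Group.IsFinitelyPresented G₂]
    (p : F →* H) (hp : Function.Surjective p)
    (p₁ : H →* G₁) (p₂ : H →* G₂) (hp₁ : Function.Surjective p₁) (hp₂ : Function.Surjective p₂)
    (hinj : p₁.ker ⊓ p₂.ker = ⊥) (hcomm : commutator H ≤ p₂.ker ⊔ p₁.ker)
    {ιA ιB ιC ιX ιY : Type*} [Finite ιA] [Fintype ιB] [Finite ιC] [Finite ιX] [Finite ιY]
    {a' : ιA → F} {b' : ιB → F} {c' : ιC → F} {x' : ιX → F} {y' : ιY → F} {D L L₂ M R : ℕ}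
    (T : Rels (p ∘ a') (p ∘ b') (p ∘ c') (p ∘ x') (p ∘ y') D L L₂ M R)
    (hD : 1 ≤ D) (hL : D * D + D + 1 ≤ L)
    (hLM : L ≤ M) (hM : D * L₂ + 1 ≤ M) (h2 : 2 ≤ R) (hR : Fintype.card ιB * M ≤ R)
    (hgen' : Subgroup.closure (Set.range a' ∪ Set.range b' ∪ Set.range c' ∪ Set.range x' ∪
      Set.range y') = ⊤)
    (hx : p₂.ker = Subgroup.normalClosure (Set.range (p ∘ x')))
    (hy : p₁.ker = Subgroup.normalClosure (Set.range (p ∘ y'))) : Group.IsFinitelyPresented H := by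
  let R₁ := (p₂.comp p).ker
  let R₂ := (p₁.comp p).ker
  have hR₁ : R₁.IsFinitelyNormallyGenerated := ker_fng_of_fp (p₂.comp p) (hp₂.comp hp)
  have hR₂ : R₂.IsFinitelyNormallyGenerated := ker_fng_of_fp (p₁.comp p) (hp₁.comp hp)
  have hK : R₁ ⊓ R₂ = p.ker := by
    ext z
    have : p z ∈ p₁.ker ⊓ p₂.ker ↔ p z = 1 := by rw [hinj]; simp
    simp only [Subgroup.mem_inf, MonoidHom.mem_ker, R₁, R₂, MonoidHom.comp_apply] at this ⊢
    rw [← this, and_comm]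
  -- eventually good
  have ev1 : ∀ᶠ S : Finset p.ker in atTop, R₁ ≤ (Subgroup.normalClosure
      (Set.range (QuotientGroup.mk' (relN p S) ∘ x'))).comap (QuotientGroup.mk' (relN p S)) := by
    obtain ⟨S₁, hf, hS₁⟩ := hR₁
    have : ∀ᶠ S : Finset p.ker in atTop, ∀ s ∈ S₁, QuotientGroup.mk' (relN p S) s ∈
        Subgroup.normalClosure (Set.range (QuotientGroup.mk' (relN p S) ∘ x')) := by
      rw [eventually_all_finite hf]
      intro s hs
      refine ev_nc hp ?_
      have : s ∈ R₁ := hS₁ ▸ Subgroup.subset_normalClosure hs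
      rw [← hx]
      exact this
    filter_upwards [this] with S hS
    rw [← hS₁]
    exact Subgroup.normalClosure_le_normal hS
  have ev2 : ∀ᶠ S : Finset p.ker in atTop, R₂ ≤ (Subgroup.normalClosure
      (Set.range (QuotientGroup.mk' (relN p S) ∘ y'))).comap (QuotientGroup.mk' (relN p S)) := by
    obtain ⟨S₁, hf, hS₁⟩ := hR₂
    have : ∀ᶠ S : Finset p.ker in atTop, ∀ s ∈ S₁, QuotientGroup.mk' (relN p S) s ∈
        Subgroup.normalClosure (Set.range (QuotientGroup.mk' (relN p S) ∘ y')) := by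
      rw [eventually_all_finite hf]
      intro s hs
      refine ev_nc hp ?_
      have : s ∈ R₂ := hS₁ ▸ Subgroup.subset_normalClosure hs
      rw [← hy]
      exact this
    filter_upwards [this] with S hS
    rw [← hS₁]
    exact Subgroup.normalClosure_le_normal hS
  have ev3 := ev_Rels (p := p) (a := a') (b := b') (c := c') (x := x') (y := y')
    (D := D) (L := L) (L₂ := L₂) (M := M) (R := R) T
  obtain ⟨S, h1, h2', h3⟩ := (ev1.and (ev2.and ev3)).exists
  have hcomS : ⁅R₁, R₂⁆ ≤ relN p S := by
    rw [Subgroup.commutator_le]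
    intro u hu v hv
    have hq : Subgroup.closure (Set.range (QuotientGroup.mk' (relN p S) ∘ a') ∪
        Set.range (QuotientGroup.mk' (relN p S) ∘ b') ∪
        Set.range (QuotientGroup.mk' (relN p S) ∘ c') ∪
        Set.range (QuotientGroup.mk' (relN p S) ∘ x') ∪
        Set.range (QuotientGroup.mk' (relN p S) ∘ y')) = ⊤ := by
      simp only [Set.range_comp, ← Set.image_union]
      rw [← MonoidHom.map_closure, hgen', Subgroup.map_top_of_surjective _
        (QuotientGroup.mk'_surjective _)]
    have := normalClosures_commute h3 hD hL hLM hM h2 hR hq (h1 hu) (h2' hv)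
    rw [← commutatorElement_eq_one_iff_commute, ← map_commutatorElement] at this
    exact (QuotientGroup.eq_one_iff _).1 this
  have hcF : commutator F ≤ R₁ ⊔ R₂ := by
    have e1 : R₁ = p₂.ker.comap p := rfl
    have e2 : R₂ = p₁.ker.comap p := rfl
    rw [e1, e2, Subgroup.comap_sup_eq _ _ _ hp, ← Subgroup.map_le_iff_le_comap]
    refine le_trans ?_ hcomm
    rw [commutator_def, commutator_def, Subgroup.map_commutator]
    exact Subgroup.commutator_mono le_top le_top
  have hsub : ((fun s : p.ker => (s : F)) '' (S : Set p.ker)) ⊆ (R₁ ⊓ R₂ : Subgroup F) := by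
    rintro _ ⟨s, _, rfl⟩
    show (s : F) ∈ R₁ ⊓ R₂
    rw [hK]
    exact s.2
  have hfin : (R₁ ⊓ R₂).IsFinitelyNormallyGenerated :=
    thmA R₁ R₂ hR₁ hR₂ hcF (S.finite_toSet.image _) hsub hcomS
  have hfin' : p.ker.IsFinitelyNormallyGenerated := hK ▸ hfin
  exact Group.IsFinitelyPresented.of_surjective p hp hfin'

theorem thmB {H G₁ G₂ : Type*} [Group H] [Group G₁] [Group G₂]
    [Group.IsFinitelyPresented G₁] [Group.IsFinitelyPresented G₂]
    (p₁ : H →* G₁) (p₂ : H →* G₂) (hp₁ : Function.Surjective p₁) (hp₂ : Function.Surjective p₂)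
    (hinj : p₁.ker ⊓ p₂.ker = ⊥) (hcomm : commutator H ≤ p₂.ker ⊔ p₁.ker)
    {ιA ιB ιC ιX ιY : Type*} [Finite ιA] [Fintype ιB] [Finite ιC] [Finite ιX] [Finite ιY]
    {a : ιA → H} {b : ιB → H} {c : ιC → H} {x : ιX → H} {y : ιY → H} {D L L₂ M R : ℕ}
    (T : Rels a b c x y D L L₂ M R)
    (hD : 1 ≤ D) (hL : D * D + D + 1 ≤ L)
    (hLM : L ≤ M) (hM : D * L₂ + 1 ≤ M) (h2 : 2 ≤ R) (hR : Fintype.card ιB * M ≤ R)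
    (hgen : Subgroup.closure (Set.range a ∪ Set.range b ∪ Set.range c ∪ Set.range x ∪ Set.range y)
      = ⊤)
    (hx : p₂.ker = Subgroup.normalClosure (Set.range x))
    (hy : p₁.ker = Subgroup.normalClosure (Set.range y)) : Group.IsFinitelyPresented H := by
  let p : FreeGroup (ιA ⊕ ιB ⊕ ιC ⊕ ιX ⊕ ιY) →* H :=
    FreeGroup.lift (Sum.elim a (Sum.elim b (Sum.elim c (Sum.elim x y))))
  let a' : ιA → FreeGroup (ιA ⊕ ιB ⊕ ιC ⊕ ιX ⊕ ιY) := fun i => FreeGroup.of (.inl i)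
  let b' : ιB → FreeGroup (ιA ⊕ ιB ⊕ ιC ⊕ ιX ⊕ ιY) := fun i => FreeGroup.of (.inr (.inl i))
  let c' : ιC → FreeGroup (ιA ⊕ ιB ⊕ ιC ⊕ ιX ⊕ ιY) := fun i => FreeGroup.of (.inr (.inr (.inl i)))
  let x' : ιX → FreeGroup (ιA ⊕ ιB ⊕ ιC ⊕ ιX ⊕ ιY) :=
    fun i => FreeGroup.of (.inr (.inr (.inr (.inl i))))
  let y' : ιY → FreeGroup (ιA ⊕ ιB ⊕ ιC ⊕ ιX ⊕ ιY) :=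
    fun i => FreeGroup.of (.inr (.inr (.inr (.inr i))))
  have ha : p ∘ a' = a := by ext i; simp [p, a']
  have hb : p ∘ b' = b := by ext i; simp [p, b']
  have hc : p ∘ c' = c := by ext i; simp [p, c']
  have hx' : p ∘ x' = x := by ext i; simp [p, x']
  have hy' : p ∘ y' = y := by ext i; simp [p, y']
  have hgen' : Subgroup.closure (Set.range a' ∪ Set.range b' ∪ Set.range c' ∪ Set.range x' ∪
      Set.range y') = ⊤ := by
    rw [← FreeGroup.closure_range_of]
    congr 1
    ext z
    simp only [Set.mem_union, Set.mem_range, Sum.exists, a', b', c', x', y', or_assoc]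
  have hp : Function.Surjective p := by
    rw [← MonoidHom.range_eq_top, eq_top_iff, ← hgen, ← ha, ← hb, ← hc, ← hx', ← hy',
      Subgroup.closure_le]
    rintro g ((((⟨i, rfl⟩ | ⟨i, rfl⟩) | ⟨i, rfl⟩) | ⟨i, rfl⟩) | ⟨i, rfl⟩) <;> exact ⟨_, rfl⟩
  exact thmB' (a' := a') (b' := b') (c' := c') (x' := x') (y' := y') p hp p₁ p₂ hp₁ hp₂ hinj hcomm
    (by rw [ha, hb, hc, hx', hy']; exact T) hD hL hLM hM h2 hR hgen'
    (by rw [hx']; exact hx) (by rw [hy']; exact hy)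

end ThmB
end FibreFP

/-! ### Part 4: generation lemmas -/

namespace FibreFP

section Gen
open scoped commutatorElement

theorem commutator_fng {K : Type*} [Group K] [hK : Group.FG K] :
    (commutator K).IsFinitelyNormallyGenerated := by
  obtain ⟨T, hT, hTf⟩ := Group.fg_iff.1 hK
  refine ⟨(fun q : K × K => ⁅q.1, q.2⁆) '' (T ×ˢ T), (hTf.prod hTf).image _, ?_⟩
  set N := Subgroup.normalClosure ((fun q : K × K => ⁅q.1, q.2⁆) '' (T ×ˢ T)) with hN
  apply le_antisymm
  · refine Subgroup.normalClosure_le_normal ?_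
    rintro _ ⟨⟨a, b⟩, _, rfl⟩
    exact Subgroup.commutator_mem_commutator (Subgroup.mem_top _) (Subgroup.mem_top _)
  · let π := QuotientGroup.mk' N
    have h1 : ∀ s ∈ T, ∀ t ∈ T, Commute (π s) (π t) := by
      intro s hs t ht
      rw [← commutatorElement_eq_one_iff_commute, ← map_commutatorElement]
      exact (QuotientGroup.eq_one_iff _).2
        (Subgroup.subset_normalClosure ⟨⟨s, t⟩, ⟨hs, ht⟩, rfl⟩)
    have h2 : ∀ s ∈ T, ∀ v, Commute (π s) (π v) := by
      intro s hs v
      have : (⊤ : Subgroup K) ≤ (Subgroup.centralizer {π s}).comap π := by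
        rw [← hT, Subgroup.closure_le]
        intro t ht
        exact Subgroup.mem_centralizer_singleton_iff.2 (h1 t ht s hs).eq
      exact (Subgroup.mem_centralizer_singleton_iff.1 (this (Subgroup.mem_top v))).symm
    have h3 : ∀ u v, Commute (π u) (π v) := by
      intro u v
      have : (⊤ : Subgroup K) ≤ (Subgroup.centralizer {π v}).comap π := by
        rw [← hT, Subgroup.closure_le]
        intro t ht
        exact Subgroup.mem_centralizer_singleton_iff.2 (h2 t ht v).eq
      exact Subgroup.mem_centralizer_singleton_iff.1 (this (Subgroup.mem_top u))
    rw [commutator_def, Subgroup.commutator_le]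
    intro u _ v _
    have := h3 u v
    rw [← commutatorElement_eq_one_iff_commute, ← map_commutatorElement] at this
    exact (QuotientGroup.eq_one_iff _).1 this

theorem ker_fng_of_comm {K A : Type*} [Group K] [Group.FG K] [CommGroup A] (f : K →* A) :
    f.ker.IsFinitelyNormallyGenerated := by
  obtain ⟨S, hSf, hS, hle⟩ := noeth' (⊤ : Subgroup K) ⊤ le_rfl le_top
    (Subgroup.IsFinitelyNormallyGenerated.of_FG _) f.ker le_top
  obtain ⟨C, hCf, hC⟩ := commutator_fng (K := K)
  have hcl : commutator K ≤ f.ker := Abelianization.commutator_subset_ker f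
  have hCle : C ⊆ f.ker := fun z hz => hcl (hC ▸ Subgroup.subset_normalClosure hz)
  refine ⟨S ∪ C, hSf.union hCf, le_antisymm
    (Subgroup.normalClosure_le_normal (Set.union_subset hS hCle)) (hle.trans ?_)⟩
  refine sup_le (Subgroup.normalClosure_mono Set.subset_union_left) ?_
  rw [← commutator_def, ← hC]
  exact Subgroup.normalClosure_mono Set.subset_union_right

lemma exists_word {G P I : Type*} [Group G] [Group P] (θ : G →* P) (b : I → G) {g : G}
    (hg : θ g ∈ Subgroup.closure (Set.range (θ ∘ b))) :
    ∃ u ∈ Subgroup.closure (Set.range b), u⁻¹ * g ∈ θ.ker := by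
  rw [Set.range_comp, ← MonoidHom.map_closure] at hg
  obtain ⟨u, hu, he⟩ := hg
  exact ⟨u, hu, by simp [MonoidHom.mem_ker, he]⟩

theorem exists_gen {G P I : Type*} [Group G] [CommGroup P] (θ : G →* P) (b : I → G)
    (hinv : ∀ i, ∃ j, b j = (b i)⁻¹)
    (hK : ((Subgroup.closure (Set.range (θ ∘ b))).comap θ).FG) {Z : Set G} (hZf : Z.Finite)
    (hZ : Z ⊆ θ.ker) :
    ∃ X : Set G, X.Finite ∧ Z ⊆ X ∧ X ⊆ θ.ker ∧
      ∀ n ∈ θ.ker, ∃ r, n ∈ cl (Subtype.val : X → G) b r := by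
  set K := (Subgroup.closure (Set.range (θ ∘ b))).comap θ with hKdef
  have hKfg : Group.FG K := (Group.fg_iff_subgroup_fg K).2 hK
  obtain ⟨S, hSf, hS⟩ := ker_fng_of_comm (θ.comp K.subtype)
  have hNK : θ.ker ≤ K := by
    intro n hn
    rw [hKdef, Subgroup.mem_comap, MonoidHom.mem_ker.1 hn]
    exact Subgroup.one_mem _
  obtain ⟨T, hT, hTf⟩ := (Subgroup.fg_iff K).1 hK
  have hTK : T ⊆ K := hT ▸ Subgroup.subset_closure
  have hw : ∀ t : T, ∃ u ∈ Subgroup.closure (Set.range b), u⁻¹ * (t : G) ∈ θ.ker :=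
    fun t => exists_word θ b (hTK t.2)
  choose u hu hu' using hw
  have hTf' : Finite T := hTf
  refine ⟨Z ∪ K.subtype '' S ∪ Set.range (fun t : T => (u t)⁻¹ * (t : G)),
    (hZf.union (hSf.image _)).union (Set.finite_range _), by grind, ?_, ?_⟩
  · rintro z ((hz | ⟨s, hs, rfl⟩) | ⟨t, rfl⟩)
    · exact hZ hz
    · have : s ∈ (θ.comp K.subtype).ker := hS ▸ Subgroup.subset_normalClosure hs
      exact this
    · exact hu' t
  set X := Z ∪ K.subtype '' S ∪ Set.range (fun t : T => (u t)⁻¹ * (t : G)) with hX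
  have hmono : Monotone (cl (Subtype.val : X → G) b) := fun _ _ h => cl_mono h
  set E : Subgroup G := ⨆ r, cl (Subtype.val : X → G) b r with hE
  have hmemE : ∀ {z}, z ∈ E ↔ ∃ r, z ∈ cl (Subtype.val : X → G) b r := by
    intro z
    exact Subgroup.mem_iSup_of_directed hmono.directed_le
  have hXE : ∀ z ∈ X, z ∈ E := fun z hz =>
    hmemE.2 ⟨0, cl_base (x := (Subtype.val : X → G)) ⟨z, hz⟩ 0⟩
  have hbE : ∀ i, ∀ z ∈ E, cj (b i) z ∈ E := by
    intro i z hz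
    obtain ⟨r, hr⟩ := hmemE.1 hz
    exact hmemE.2 ⟨r + 1, cl_cj i hr⟩
  have hbn : ∀ i, b i ∈ Subgroup.normalizer (E : Set G) := by
    intro i
    obtain ⟨j, hj⟩ := hinv i
    rw [Subgroup.mem_normalizer_iff]
    intro z
    constructor
    · intro hz
      have := hbE j z hz
      simpa [cj, hj] using this
    · intro hz
      have := hbE i _ hz
      simpa [cj, mul_assoc] using this
  have hbn' : Subgroup.closure (Set.range b) ≤ Subgroup.normalizer (E : Set G) := by
    rw [Subgroup.closure_le]
    rintro _ ⟨i, rfl⟩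
    exact hbn i
  have hKn : K ≤ Subgroup.normalizer (E : Set G) := by
    rw [← hT, Subgroup.closure_le]
    intro t ht
    have h1 := hbn' (hu ⟨t, ht⟩)
    have h2 : (u ⟨t, ht⟩)⁻¹ * t ∈ Subgroup.normalizer (E : Set G) :=
      Subgroup.le_normalizer (hXE _ (Or.inr ⟨⟨t, ht⟩, rfl⟩))
    have := Subgroup.mul_mem _ h1 h2
    simpa using this
  have hn : (E.subgroupOf K).Normal :=
    ⟨fun n hn g => (Subgroup.mem_normalizer_iff.1 (hKn g.2) n).1 hn⟩
  have hle : (θ.comp K.subtype).ker ≤ E.subgroupOf K := by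
    rw [← hS]
    refine Subgroup.normalClosure_le_normal ?_
    intro s hs
    exact hXE _ (Or.inl (Or.inr ⟨s, hs, rfl⟩))
  intro n hn
  have : (⟨n, hNK hn⟩ : K) ∈ (θ.comp K.subtype).ker := hn
  exact hmemE.1 (hle this)

/-- membership in `cl` can be lifted along a jointly injective pair. -/
lemma cl_lift {H G₁ G₂ ι κ : Type*} [Group H] [Group G₁] [Group G₂] (p₁ : H →* G₁) (p₂ : H →* G₂)
    (hinj : ∀ h, p₁ h = 1 → p₂ h = 1 → h = 1) (x : ι → H) (b : κ → H) (hx : ∀ i, p₂ (x i) = 1)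
    {r : ℕ} {h : H} (h2 : p₂ h = 1) (h1 : p₁ h ∈ cl (p₁ ∘ x) (p₁ ∘ b) r) : h ∈ cl x b r := by
  rw [← map_cl] at h1
  obtain ⟨w, hw, he⟩ := h1
  have hle : cl x b r ≤ p₂.ker := by
    refine cl_le fun l i _ => ?_
    simp [MonoidHom.mem_ker, hx, cj]
  have hw2 : p₂ w = 1 := hle hw
  have : w⁻¹ * h = 1 := hinj _ (by simp [he]) (by simp [hw2, h2])
  rwa [inv_mul_eq_one.1 this] at hw

end Gen
end FibreFP

/-! ### Part 5: fibre products with prescribed letters -/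

namespace FibreFP

section FibreA

theorem thmC0 {H G₁ G₂ P IA IB IC : Type*} [Group H] [Group G₁] [Group G₂] [CommGroup P]
    [Finite IA] [Fintype IB] [Finite IC]
    [Group.IsFinitelyPresented G₁] [Group.IsFinitelyPresented G₂]
    (p₁ : H →* G₁) (p₂ : H →* G₂) (hinj : ∀ h, p₁ h = 1 → p₂ h = 1 → h = 1)
    (θ₁ : G₁ →* P) (θ₂ : G₂ →* P) (hθ₁ : Function.Surjective θ₁) (hθ₂ : Function.Surjective θ₂)
    (τ : P ≃* P) (hrel : ∀ h, τ (θ₁ (p₁ h)) = θ₂ (p₂ h))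
    (hlift : ∀ g₁ g₂, τ (θ₁ g₁) = θ₂ g₂ → ∃ h, p₁ h = g₁ ∧ p₂ h = g₂)
    (a₁ : IA → G₁) (a₂ : IA → G₂) (s₂ : IA → G₂) (b₁ : IB → G₁) (b₂ : IB → G₂)
    (c₁ : IC → G₁) (c₂ : IC → G₂)
    (ha : ∀ j, τ (θ₁ (a₁ j)) = θ₂ (a₂ j)) (hb : ∀ j, τ (θ₁ (b₁ j)) = θ₂ (b₂ j))
    (hc : ∀ j, τ (θ₁ (c₁ j)) = θ₂ (c₂ j))
    (hbinv : ∀ i, ∃ i', b₁ i' = (b₁ i)⁻¹ ∧ b₂ i' = (b₂ i)⁻¹)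
    (hcinv : ∀ i, ∃ i', c₁ i' = (c₁ i)⁻¹ ∧ c₂ i' = (c₂ i)⁻¹)
    (ainv : IA → IA) (hainv : ∀ j, θ₁ (a₁ j * a₁ (ainv j)) = 1)
    (hgenP : Subgroup.closure (Set.range (θ₁ ∘ a₁) ∪ Set.range (θ₁ ∘ b₁) ∪ Set.range (θ₁ ∘ c₁)) = ⊤)
    {X : Set G₁} {Y : Set G₂} [Finite X] [Finite Y] (hXk : X ⊆ θ₁.ker) (hYk : Y ⊆ θ₂.ker)
    (hX : ∀ n ∈ θ₁.ker, ∃ r, n ∈ cl (Subtype.val : X → G₁) b₁ r)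
    (hY : ∀ n ∈ θ₂.ker, ∃ r, n ∈ cl (Subtype.val : Y → G₂) (Sum.elim b₂ c₂) r)
    (hbbX : ∀ i j, b₁ i * b₁ j * (b₁ j * b₁ i)⁻¹ ∈ X)
    (hbbX' : ∀ i j, (b₁ j * b₁ i)⁻¹ * (b₁ i * b₁ j) ∈ X)
    (hbbY : ∀ i j, b₂ i * b₂ j * (b₂ j * b₂ i)⁻¹ ∈ Y)
    (hbbY' : ∀ i j, (b₂ j * b₂ i)⁻¹ * (b₂ i * b₂ j) ∈ Y)
    (hbaX : ∀ i j, b₁ i * a₁ j * (a₁ j * b₁ i)⁻¹ ∈ X)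
    (hbaX' : ∀ i j, (a₁ j * b₁ i)⁻¹ * (b₁ i * a₁ j) ∈ X)
    (haaX : ∀ j, a₁ j * a₁ (ainv j) ∈ X)
    (hbcX : ∀ i j, b₁ i * c₁ j * (c₁ j * b₁ i)⁻¹ ∈ X)
    (hbcY : ∀ i j, b₂ i * c₂ j * (c₂ j * b₂ i)⁻¹ ∈ Y)
    {D L L₂ M : ℕ}
    (htype : ∀ i, (∃ e, 0 < e ∧ e ≤ M ∧ b₁ i ^ e ∈ X ∧ b₂ i ^ e ∈ Y) ∨
      ∃ j, a₂ j = b₂ i ^ L * s₂ j ∧ (s₂ j * b₂ i)⁻¹ * (b₂ i * s₂ j) ∈ Y)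
    (hD : 1 ≤ D) (hL : D * D + D + 1 ≤ L) (hLM : L ≤ M) (hM : D * L₂ + 1 ≤ M)
    (hDa : ∀ z ∈ X, ∀ j, cj (a₁ j) z ∈ cl (Subtype.val : X → G₁) b₁ D)
    (hDc : ∀ z ∈ X, ∀ j, cj (c₁ j) z ∈ cl (Subtype.val : X → G₁) b₁ D)
    (hDs : ∀ z ∈ Y, ∀ j, cj (s₂ j) z ∈ cl (Subtype.val : Y → G₂) (Sum.elim b₂ c₂) D)
    (hL2a : ∀ i j, b₂ i * a₂ j * (a₂ j * b₂ i)⁻¹ ∈ cl (Subtype.val : Y → G₂) (Sum.elim b₂ c₂) L₂)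
    (hL2b : ∀ j, a₂ j * a₂ (ainv j) ∈ cl (Subtype.val : Y → G₂) (Sum.elim b₂ c₂) L₂) :
    Group.IsFinitelyPresented H := by
  have hj : ∀ {u v : H}, p₁ u = p₁ v → p₂ u = p₂ v → u = v := by
    intro u v h1 h2
    exact inv_mul_eq_one.1 (hinj (u⁻¹ * v) (by simp [h1]) (by simp [h2]))
  choose a ha1 ha2 using fun j => hlift (a₁ j) (a₂ j) (ha j)
  choose b hb1 hb2 using fun j => hlift (b₁ j) (b₂ j) (hb j)
  choose c hc1 hc2 using fun j => hlift (c₁ j) (c₂ j) (hc j)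
  have hX1 : ∀ z : X, θ₁ z = 1 := fun z => hXk z.2
  have hY1 : ∀ z : Y, θ₂ z = 1 := fun z => hYk z.2
  choose x hx1 hx2 using fun z : X => hlift z 1 (by simp [hX1 z])
  choose y hy1 hy2 using fun z : Y => hlift 1 z (by simp [hY1 z])
  have ex : p₁ ∘ x = Subtype.val := funext hx1
  have ey : p₂ ∘ y = Subtype.val := funext hy2
  have eb : p₁ ∘ b = b₁ := funext hb1
  have ebc : p₂ ∘ Sum.elim b c = Sum.elim b₂ c₂ := by
    rw [Sum.comp_elim, show p₂ ∘ b = b₂ from funext hb2, show p₂ ∘ c = c₂ from funext hc2]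
  have liftX : ∀ {h : H} {r : ℕ}, p₂ h = 1 → p₁ h ∈ cl (Subtype.val : X → G₁) b₁ r →
      h ∈ cl x b r := by
    intro h r h2 h1
    refine cl_lift p₁ p₂ hinj x b hx2 h2 ?_
    rwa [ex, eb]
  have liftY : ∀ {h : H} {r : ℕ}, p₁ h = 1 → p₂ h ∈ cl (Subtype.val : Y → G₂) (Sum.elim b₂ c₂) r →
      h ∈ cl y (Sum.elim b c) r := by
    intro h r h2 h1
    refine cl_lift p₂ p₁ (fun h h1 h2 => hinj h h2 h1) y _ hy1 h2 ?_
    rwa [ey, ebc]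
  have hcommP : ∀ {u v : G₂}, θ₂ (u * v * (v * u)⁻¹) = 1 := by
    intro u v
    rw [map_mul, map_inv, map_mul, map_mul, mul_comm (θ₂ v), mul_inv_cancel]
  have T : Rels a b c x y D L L₂ M (2 + Fintype.card IB * M) := by
    refine ⟨?_, ?_, ?_, ?_, ?_, ?_, ?_, ?_, ?_, ?_, ?_⟩
    · intro i j
      refine ⟨⟨_, hbbX i j⟩, ⟨_, hbbY i j⟩, hj ?_ ?_⟩ <;> simp [hx1, hx2, hy1, hy2, hb1, hb2, mul_assoc]
    · intro i j
      refine ⟨⟨_, hbbX' i j⟩, ⟨_, hbbY' i j⟩, hj ?_ ?_⟩ <;>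
        simp [hx1, hx2, hy1, hy2, hb1, hb2, mul_assoc]
    · intro i
      obtain ⟨i', h1, h2⟩ := hbinv i
      exact ⟨i', hj (by simp [hb1, h1]) (by simp [hb2, h2])⟩
    · intro i
      obtain ⟨i', h1, h2⟩ := hcinv i
      exact ⟨i', hj (by simp [hc1, h1]) (by simp [hc2, h2])⟩
    · intro i j
      obtain ⟨w, hw1, hw2⟩ := hlift 1 (b₂ i * a₂ j * (a₂ j * b₂ i)⁻¹) (by rw [hcommP, map_one, map_one])
      refine ⟨⟨_, hbaX i j⟩, w, liftY hw1 (hw2 ▸ hL2a i j), hj ?_ ?_⟩ <;>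
        simp [hx1, hx2, hb1, hb2, ha1, ha2, hw1, hw2, mul_assoc]
    · intro i j
      refine ⟨⟨_, hbcX i j⟩, ⟨_, hbcY i j⟩, hj ?_ ?_⟩ <;>
        simp [hx1, hx2, hy1, hy2, hb1, hb2, hc1, hc2, mul_assoc]
    · intro i j
      refine liftX (by simp [cj, hx2]) ?_
      rw [map_cj, ha1, hx1]
      exact hDa _ i.2 j
    · intro i j
      refine liftX (by simp [cj, hx2]) ?_
      rw [map_cj, hc1, hx1]
      exact hDc _ i.2 j
    · intro i
      rcases htype i with ⟨e, he, heM, h1, h2⟩ | ⟨j, h1, h2⟩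
      · refine Or.inl ⟨e, ⟨_, h1⟩, ⟨_, h2⟩, he, heM, hj ?_ ?_⟩ <;>
          simp [hx1, hx2, hy1, hy2, hb1, hb2, mul_assoc]
      · refine Or.inr ⟨j, ⟨⟨_, hbaX' i j⟩, ⟨_, h2⟩, hj ?_ ?_⟩, ?_⟩
        · simp [hx1, hy1, hb1, ha1, mul_assoc]
        · simp only [map_mul, hx2, hy2, hb2, ha2, h1]
          rw [one_mul, mul_assoc (b₂ i ^ L), mul_assoc, mul_assoc,
            ← mul_assoc (s₂ j) (b₂ i), mul_inv_cancel_left, ← mul_assoc, ← mul_assoc,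
            (Commute.self_pow (b₂ i) L).eq]
        · intro t
          refine liftY (by simp [cj, hy1]) ?_
          rw [map_cj, hy2, map_mul, map_inv, map_pow, hb2, ha2, h1, inv_mul_cancel_left]
          exact hDs _ t.2 j
    · intro j
      have e1 : τ (θ₁ (a₁ j * a₁ (ainv j))) = θ₂ (a₂ j * a₂ (ainv j)) := by
        rw [map_mul, map_mul, ha, ha, map_mul]
      rw [hainv, map_one] at e1
      obtain ⟨w, hw1, hw2⟩ := hlift 1 (a₂ j * a₂ (ainv j)) (by rw [← e1]; simp)
      refine ⟨ainv j, ⟨_, haaX j⟩, w, liftY hw1 (hw2 ▸ hL2b j), hj ?_ ?_⟩ <;>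
        simp [hx1, hx2, ha1, ha2, hw1, hw2, mul_assoc]
    · intro l s t _
      refine hj ?_ ?_ <;> simp [cj, hx2, hy1]
  have hX2 : ∀ h, p₂ h = 1 → ∃ r, h ∈ cl x b r := by
    intro h h2
    have : θ₁ (p₁ h) = 1 := by
      have := hrel h
      rw [h2, map_one] at this
      simpa using this
    obtain ⟨r, hr⟩ := hX _ this
    exact ⟨r, liftX h2 hr⟩
  have hY2 : ∀ h, p₁ h = 1 → ∃ r, h ∈ cl y (Sum.elim b c) r := by
    intro h h1
    have : θ₂ (p₂ h) = 1 := by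
      rw [← hrel h, h1, map_one, map_one]
    obtain ⟨r, hr⟩ := hY _ this
    exact ⟨r, liftY h1 hr⟩
  refine thmB p₁ p₂ ?_ ?_ ?_ ?_ T hD hL hLM hM (by omega) (by omega) ?_ ?_ ?_
  · intro g
    obtain ⟨g', hg⟩ := hθ₂ (τ (θ₁ g))
    obtain ⟨h, h1, _⟩ := hlift g g' hg.symm
    exact ⟨h, h1⟩
  · intro g
    obtain ⟨g', hg⟩ := hθ₁ (τ.symm (θ₂ g))
    obtain ⟨h, _, h1⟩ := hlift g' g (by simp [hg])
    exact ⟨h, h1⟩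
  · rw [eq_bot_iff]
    rintro h ⟨h1, h2⟩
    exact hinj h h1 h2
  · intro h hh
    have h1 : θ₁ (p₁ h) = 1 := Abelianization.commutator_subset_ker (θ₁.comp p₁) hh
    obtain ⟨u, hu1, hu2⟩ := hlift (p₁ h) 1 (by simp [h1])
    have : h = u * (u⁻¹ * h) := by simp
    rw [this]
    exact Subgroup.mul_mem_sup (by simp [MonoidHom.mem_ker, hu2])
      (by simp [MonoidHom.mem_ker, hu1])
  · set C := Subgroup.closure
      (Set.range a ∪ Set.range b ∪ Set.range c ∪ Set.range x ∪ Set.range y) with hC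
    have hCa : ∀ j, a j ∈ C := fun j => Subgroup.subset_closure (by simp)
    have hCb : ∀ j, b j ∈ C := fun j => Subgroup.subset_closure (by simp)
    have hCc : ∀ j, c j ∈ C := fun j => Subgroup.subset_closure (by simp)
    have hCx : ∀ j, x j ∈ C := fun j => Subgroup.subset_closure (Or.inl (Or.inr ⟨j, rfl⟩))
    have hCy : ∀ j, y j ∈ C := fun j => Subgroup.subset_closure (Or.inr ⟨j, rfl⟩)
    have k2 : ∀ h, p₂ h = 1 → h ∈ C := by
      intro h h2
      obtain ⟨r, hr⟩ := hX2 h h2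
      refine cl_le (S := C) (fun l i _ => cj_mem _ (Subgroup.list_prod_mem _ ?_) (hCx i)) hr
      intro z hz
      obtain ⟨i, _, rfl⟩ := List.mem_map.1 hz
      exact hCb i
    have k1 : ∀ h, p₁ h = 1 → h ∈ C := by
      intro h h1
      obtain ⟨r, hr⟩ := hY2 h h1
      refine cl_le (S := C) (fun l i _ => cj_mem _ (Subgroup.list_prod_mem _ ?_) (hCy i)) hr
      intro z hz
      obtain ⟨i, _, rfl⟩ := List.mem_map.1 hz
      rcases i with i | i
      · exact hCb i
      · exact hCc i
    have hmap : C.map (θ₁.comp p₁) = ⊤ := by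
      rw [eq_top_iff, ← hgenP, Subgroup.closure_le]
      rintro _ ((⟨j, rfl⟩ | ⟨j, rfl⟩) | ⟨j, rfl⟩)
      · exact ⟨a j, hCa j, by simp [ha1]⟩
      · exact ⟨b j, hCb j, by simp [hb1]⟩
      · exact ⟨c j, hCc j, by simp [hc1]⟩
    rw [eq_top_iff]
    intro h _
    have : θ₁ (p₁ h) ∈ C.map (θ₁.comp p₁) := hmap ▸ Subgroup.mem_top _
    obtain ⟨u, hu, he⟩ := this
    have he' : θ₁ (p₁ (u⁻¹ * h)) = 1 := by
      have he : θ₁ (p₁ u) = θ₁ (p₁ h) := he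
      simp [he]
    obtain ⟨v, hv1, hv2⟩ := hlift (p₁ (u⁻¹ * h)) 1 (by simp only [he', map_one])
    have : h = u * (v * (v⁻¹ * (u⁻¹ * h))) := by simp
    rw [this]
    refine C.mul_mem hu (C.mul_mem (k2 v hv2) (k1 _ ?_))
    rw [map_mul, map_inv, hv1, inv_mul_cancel]
  · apply le_antisymm
    · intro h hh
      obtain ⟨r, hr⟩ := hX2 h hh
      refine cl_le (fun l i _ => ?_) hr
      have := (Subgroup.normalClosure_normal (s := Set.range x)).conj_mem _
        (Subgroup.subset_normalClosure ⟨i, rfl⟩) (l.map b).prod⁻¹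
      simpa [cj] using this
    · refine Subgroup.normalClosure_le_normal ?_
      rintro _ ⟨i, rfl⟩
      exact hx2 i
  · apply le_antisymm
    · intro h hh
      obtain ⟨r, hr⟩ := hY2 h hh
      refine cl_le (fun l i _ => ?_) hr
      have := (Subgroup.normalClosure_normal (s := Set.range y)).conj_mem _
        (Subgroup.subset_normalClosure ⟨i, rfl⟩) (l.map (Sum.elim b c)).prod⁻¹
      simpa [cj] using this
    · refine Subgroup.normalClosure_le_normal ?_
      rintro _ ⟨i, rfl⟩
      exact hy1 i

end FibreA
end FibreFP

/-! ### Part 6: choice of the constants -/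

namespace FibreFP

section FibreB

lemma exists_unif {G ι κ η : Type*} [Group G] [Finite η] {x : ι → G} {b : κ → G} {z : η → G}
    (h : ∀ i, ∃ r, z i ∈ cl x b r) : ∃ D, ∀ r, D ≤ r → ∀ i, z i ∈ cl x b r := by
  choose r hr using h
  have := Fintype.ofFinite η
  exact ⟨∑ i, r i, fun s hs i => cl_mono ((Finset.single_le_sum (f := r)
    (fun _ _ => Nat.zero_le _) (Finset.mem_univ i)).trans hs) (hr i)⟩

/-- The fibre product of two homomorphisms, twisted by an automorphism. -/
def fib {G₁ G₂ P : Type*} [Group G₁] [Group G₂] [CommGroup P] (θ₁ : G₁ →* P) (θ₂ : G₂ →* P)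
    (τ : P ≃* P) : Subgroup (G₁ × G₂) :=
  MonoidHom.eqLocus ((τ.toMonoidHom.comp θ₁).comp (MonoidHom.fst G₁ G₂))
    (θ₂.comp (MonoidHom.snd G₁ G₂))

lemma mem_fib {G₁ G₂ P : Type*} [Group G₁] [Group G₂] [CommGroup P] {θ₁ : G₁ →* P} {θ₂ : G₂ →* P}
    {τ : P ≃* P} {q : G₁ × G₂} : q ∈ fib θ₁ θ₂ τ ↔ τ (θ₁ q.1) = θ₂ q.2 := Iff.rfl

theorem thmC1 {G₁ G₂ P IA IB IC : Type*} [Group G₁] [Group G₂] [CommGroup P]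
    [Finite IA] [Finite IB] [Finite IC]
    [Group.IsFinitelyPresented G₁] [Group.IsFinitelyPresented G₂]
    (θ₁ : G₁ →* P) (θ₂ : G₂ →* P) (hθ₁ : Function.Surjective θ₁) (hθ₂ : Function.Surjective θ₂)
    (σ : ℕ → P ≃* P) (ν : IA → IB)
    (a₁ : IA → G₁) (s₂ : IA → G₂) (b₁ : IB → G₁) (b₂ : IB → G₂)
    (c₁ : IC → G₁) (c₂ : IC → G₂)
    (ha : ∀ L j, σ L (θ₁ (a₁ j)) = θ₂ (b₂ (ν j)) ^ L * θ₂ (s₂ j))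
    (hb : ∀ L j, σ L (θ₁ (b₁ j)) = θ₂ (b₂ j))
    (hc : ∀ L j, σ L (θ₁ (c₁ j)) = θ₂ (c₂ j))
    (hbinv : ∀ i, ∃ i', b₁ i' = (b₁ i)⁻¹ ∧ b₂ i' = (b₂ i)⁻¹)
    (hcinv : ∀ i, ∃ i', c₁ i' = (c₁ i)⁻¹ ∧ c₂ i' = (c₂ i)⁻¹)
    (ainv : IA → IA) (hainv : ∀ j, θ₁ (a₁ j * a₁ (ainv j)) = 1)
    (e : IB → ℕ) (he₁ : ∀ i, θ₁ (b₁ i) ^ e i = 1) (he₂ : ∀ i, θ₂ (b₂ i) ^ e i = 1)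
    (hν : ∀ i, 0 < e i ∨ ∃ j, ν j = i)
    (hgenP : Subgroup.closure (Set.range (θ₁ ∘ a₁) ∪ Set.range (θ₁ ∘ b₁) ∪ Set.range (θ₁ ∘ c₁)) = ⊤)
    (hK₁ : ((Subgroup.closure (Set.range (θ₁ ∘ b₁))).comap θ₁).FG)
    (hK₂ : ((Subgroup.closure (Set.range (θ₂ ∘ Sum.elim b₂ c₂))).comap θ₂).FG) :
    ∃ L, Group.IsFinitelyPresented (fib θ₁ θ₂ (σ L)) := by
  have := Fintype.ofFinite IB
  have cm1 : ∀ (u v : G₁), u * v * (v * u)⁻¹ ∈ θ₁.ker := by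
    intro u v
    rw [MonoidHom.mem_ker, map_mul, map_inv, map_mul, map_mul, mul_comm (θ₁ v), mul_inv_cancel]
  have cm1' : ∀ (u v : G₁), (v * u)⁻¹ * (u * v) ∈ θ₁.ker := by
    intro u v
    rw [MonoidHom.mem_ker, map_mul, map_inv, map_mul, map_mul, mul_comm (θ₁ v), inv_mul_cancel]
  have cm2 : ∀ (u v : G₂), u * v * (v * u)⁻¹ ∈ θ₂.ker := by
    intro u v
    rw [MonoidHom.mem_ker, map_mul, map_inv, map_mul, map_mul, mul_comm (θ₂ v), mul_inv_cancel]
  have cm2' : ∀ (u v : G₂), (v * u)⁻¹ * (u * v) ∈ θ₂.ker := by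
    intro u v
    rw [MonoidHom.mem_ker, map_mul, map_inv, map_mul, map_mul, mul_comm (θ₂ v), inv_mul_cancel]
  have hn1 : θ₁.ker.Normal := inferInstance
  have hn2 : θ₂.ker.Normal := inferInstance
  have nc1 : ∀ g, ∀ z ∈ θ₁.ker, cj g z ∈ θ₁.ker := by
    intro g z hz
    simpa [cj] using hn1.conj_mem z hz g⁻¹
  have nc2 : ∀ g, ∀ z ∈ θ₂.ker, cj g z ∈ θ₂.ker := by
    intro g z hz
    simpa [cj] using hn2.conj_mem z hz g⁻¹
  -- the finite sets of required elements
  let f₁ : (IB × IB) ⊕ (IB × IB) ⊕ (IB × IA) ⊕ (IB × IA) ⊕ IA ⊕ (IB × IC) ⊕ IB → G₁ :=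
    Sum.elim (fun q => b₁ q.1 * b₁ q.2 * (b₁ q.2 * b₁ q.1)⁻¹) <|
    Sum.elim (fun q => (b₁ q.2 * b₁ q.1)⁻¹ * (b₁ q.1 * b₁ q.2)) <|
    Sum.elim (fun q => b₁ q.1 * a₁ q.2 * (a₁ q.2 * b₁ q.1)⁻¹) <|
    Sum.elim (fun q => (a₁ q.2 * b₁ q.1)⁻¹ * (b₁ q.1 * a₁ q.2)) <|
    Sum.elim (fun j => a₁ j * a₁ (ainv j)) <|
    Sum.elim (fun q => b₁ q.1 * c₁ q.2 * (c₁ q.2 * b₁ q.1)⁻¹) <|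
    (fun i => b₁ i ^ e i)
  have hf₁ : Set.range f₁ ⊆ θ₁.ker := by
    rintro _ ⟨q | q | q | q | q | q | q, rfl⟩
    · exact cm1 _ _
    · exact cm1' _ _
    · exact cm1 _ _
    · exact cm1' _ _
    · exact hainv q
    · exact cm1 _ _
    · exact (map_pow _ _ _).trans (he₁ q)
  let f₂ : (IB × IB) ⊕ (IB × IB) ⊕ (IB × IC) ⊕ IB ⊕ IA → G₂ :=
    Sum.elim (fun q => b₂ q.1 * b₂ q.2 * (b₂ q.2 * b₂ q.1)⁻¹) <|
    Sum.elim (fun q => (b₂ q.2 * b₂ q.1)⁻¹ * (b₂ q.1 * b₂ q.2)) <|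
    Sum.elim (fun q => b₂ q.1 * c₂ q.2 * (c₂ q.2 * b₂ q.1)⁻¹) <|
    Sum.elim (fun i => b₂ i ^ e i) <|
    (fun j => (s₂ j * b₂ (ν j))⁻¹ * (b₂ (ν j) * s₂ j))
  have hf₂ : Set.range f₂ ⊆ θ₂.ker := by
    rintro _ ⟨q | q | q | q | q, rfl⟩
    · exact cm2 _ _
    · exact cm2' _ _
    · exact cm2 _ _
    · exact (map_pow _ _ _).trans (he₂ q)
    · exact cm2' _ _
  have hbinv₁ : ∀ i, ∃ j, b₁ j = (b₁ i)⁻¹ := fun i => (hbinv i).imp fun _ h => h.1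
  have hbinv₂ : ∀ i, ∃ j, Sum.elim b₂ c₂ j = (Sum.elim b₂ c₂ i)⁻¹ := by
    rintro (i | i)
    · obtain ⟨j, -, hj⟩ := hbinv i
      exact ⟨.inl j, hj⟩
    · obtain ⟨j, -, hj⟩ := hcinv i
      exact ⟨.inr j, hj⟩
  obtain ⟨X, hXf, hZX, hXk, hX⟩ := exists_gen θ₁ b₁ hbinv₁ hK₁ (Set.finite_range f₁) hf₁
  obtain ⟨Y, hYf, hZY, hYk, hY⟩ := exists_gen θ₂ (Sum.elim b₂ c₂) hbinv₂ hK₂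
    (Set.finite_range f₂) hf₂
  have : Finite X := hXf
  have : Finite Y := hYf
  obtain ⟨D₁, hD₁⟩ := exists_unif (z := fun q : X × IA => cj (a₁ q.2) (q.1 : G₁))
    fun q => hX _ (nc1 _ _ (hXk q.1.2))
  obtain ⟨D₂, hD₂⟩ := exists_unif (z := fun q : X × IC => cj (c₁ q.2) (q.1 : G₁))
    fun q => hX _ (nc1 _ _ (hXk q.1.2))
  obtain ⟨D₃, hD₃⟩ := exists_unif (z := fun q : Y × IA => cj (s₂ q.2) (q.1 : G₂))
    fun q => hY _ (nc2 _ _ (hYk q.1.2))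
  set D := D₁ + D₂ + D₃ + 1 with hD
  set L := D * D + D + 1 with hL
  let a₂ : IA → G₂ := fun j => b₂ (ν j) ^ L * s₂ j
  have ha₂ : ∀ j, σ L (θ₁ (a₁ j)) = θ₂ (a₂ j) := by
    intro j
    rw [ha, map_mul, map_pow]
  obtain ⟨E₁, hE₁⟩ := exists_unif
    (z := fun q : IB × IA => b₂ q.1 * a₂ q.2 * (a₂ q.2 * b₂ q.1)⁻¹)
    fun q => hY _ (cm2 _ _)
  obtain ⟨E₂, hE₂⟩ := exists_unif (z := fun j : IA => a₂ j * a₂ (ainv j))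
    fun j => hY _ (by
      rw [MonoidHom.mem_ker, map_mul, ← ha₂, ← ha₂, ← map_mul, ← map_mul, hainv, map_one])
  refine ⟨L, ?_⟩
  refine thmC0 (H := fib θ₁ θ₂ (σ L)) (D := D) (L := L) (L₂ := E₁ + E₂)
    (M := L + (D * (E₁ + E₂) + 1) + ∑ i, e i) (X := X) (Y := Y)
    ((MonoidHom.fst G₁ G₂).comp (Subgroup.subtype _)) ((MonoidHom.snd G₁ G₂).comp (Subgroup.subtype _))
    ?_ θ₁ θ₂ hθ₁ hθ₂ (σ L) (fun h => h.2) (fun g₁ g₂ h => ⟨⟨(g₁, g₂), h⟩, rfl, rfl⟩)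
    a₁ a₂ s₂ b₁ b₂ c₁ c₂ ha₂ (hb L) (hc L) hbinv hcinv ainv hainv hgenP hXk hYk hX hY
    (fun i j => hZX ⟨.inl (i, j), rfl⟩) (fun i j => hZX ⟨.inr (.inl (i, j)), rfl⟩)
    (fun i j => hZY ⟨.inl (i, j), rfl⟩) (fun i j => hZY ⟨.inr (.inl (i, j)), rfl⟩)
    (fun i j => hZX ⟨.inr (.inr (.inl (i, j))), rfl⟩)
    (fun i j => hZX ⟨.inr (.inr (.inr (.inl (i, j)))), rfl⟩)
    (fun j => hZX ⟨.inr (.inr (.inr (.inr (.inl j)))), rfl⟩)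
    (fun i j => hZX ⟨.inr (.inr (.inr (.inr (.inr (.inl (i, j)))))), rfl⟩)
    (fun i j => hZY ⟨.inr (.inr (.inl (i, j))), rfl⟩)
    ?_ (by omega) le_rfl (by omega) (by omega)
    (fun z hz j => hD₁ D (by omega) (⟨z, hz⟩, j))
    (fun z hz j => hD₂ D (by omega) (⟨z, hz⟩, j))
    (fun z hz j => hD₃ D (by omega) (⟨z, hz⟩, j))
    (fun i j => hE₁ _ (by omega) (i, j)) (fun j => hE₂ _ (by omega) j)
  · rintro ⟨⟨g₁, g₂⟩, h⟩ h1 h2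
    exact Subtype.ext (Prod.ext h1 h2)
  · intro i
    rcases hν i with h | ⟨j, rfl⟩
    · refine Or.inl ⟨e i, h, ?_, hZX ⟨.inr (.inr (.inr (.inr (.inr (.inr i))))), rfl⟩,
        hZY ⟨.inr (.inr (.inr (.inl i))), rfl⟩⟩
      have := Finset.single_le_sum (f := e) (fun _ _ => Nat.zero_le _) (Finset.mem_univ i)
      omega
    · exact Or.inr ⟨j, rfl, hZY ⟨.inr (.inr (.inr (.inr j))), rfl⟩⟩

/-- signed element -/
def sg {G : Type*} [Group G] (ε : Bool) (g : G) : G := bif ε then g else g⁻¹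

lemma sg_not {G : Type*} [Group G] (ε : Bool) (g : G) : sg (!ε) g = (sg ε g)⁻¹ := by
  cases ε <;> simp [sg]

lemma map_sg {G G' : Type*} [Group G] [Group G'] (f : G →* G') (ε : Bool) (g : G) :
    f (sg ε g) = sg ε (f g) := by
  cases ε <;> simp [sg]

lemma map_sg' {G G' : Type*} [Group G] [Group G'] (f : G ≃* G') (ε : Bool) (g : G) :
    f (sg ε g) = sg ε (f g) := by
  cases ε <;> simp [sg]

lemma closure_sg {G κ : Type*} [Group G] (f : κ → G) :
    Subgroup.closure (Set.range (fun q : κ × Bool => sg q.2 (f q.1))) =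
      Subgroup.closure (Set.range f) := by
  apply le_antisymm
  · rw [Subgroup.closure_le]
    rintro _ ⟨⟨j, _ | _⟩, rfl⟩
    · exact Subgroup.inv_mem _ (Subgroup.subset_closure ⟨j, rfl⟩)
    · exact Subgroup.subset_closure ⟨j, rfl⟩
  · apply Subgroup.closure_mono
    rintro _ ⟨j, rfl⟩
    exact ⟨(j, true), rfl⟩

theorem thmC {G₁ G₂ P κ Λ Ω : Type*} [Group G₁] [Group G₂] [CommGroup P]
    [Finite κ] [Finite Λ] [Finite Ω]
    [Group.IsFinitelyPresented G₁] [Group.IsFinitelyPresented G₂]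
    (θ₁ : G₁ →* P) (θ₂ : G₂ →* P) (hθ₁ : Function.Surjective θ₁) (hθ₂ : Function.Surjective θ₂)
    (u v : κ → P) (z : Λ → P) (w : Ω → P) (hw : ∀ i, ∃ e, 0 < e ∧ w i ^ e = 1)
    (hgen : Subgroup.closure (Set.range u ∪ Set.range v ∪ Set.range z ∪ Set.range w) = ⊤)
    (hK₁ : ((Subgroup.closure (Set.range v ∪ Set.range w)).comap θ₁).FG)
    (hK₂ : ((Subgroup.closure (Set.range v ∪ Set.range w ∪ Set.range z)).comap θ₂).FG)
    (σ : ℕ → P ≃* P) (hu : ∀ L j, σ L (u j) = u j * (v j ^ L)⁻¹)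
    (hv : ∀ L j, σ L (v j) = v j) (hz : ∀ L j, σ L (z j) = z j) (hw' : ∀ L j, σ L (w j) = w j) :
    ∃ L, Group.IsFinitelyPresented (fib θ₁ θ₂ (σ L)) := by
  choose u₁ hu₁ using fun j => hθ₁ (u j)
  choose u₂ hu₂ using fun j => hθ₂ (u j)
  choose v₁ hv₁ using fun j => hθ₁ (Sum.elim v w j)
  choose v₂ hv₂ using fun j => hθ₂ (Sum.elim v w j)
  choose z₁ hz₁ using fun j => hθ₁ (z j)
  choose z₂ hz₂ using fun j => hθ₂ (z j)
  choose e he0 he using hw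
  have e1 : θ₁ ∘ (fun q : (κ ⊕ Ω) × Bool => sg q.2 (v₁ q.1)) =
      fun q : (κ ⊕ Ω) × Bool => sg q.2 (Sum.elim v w q.1) := by
    funext q; simp [map_sg, hv₁]
  have e2 : θ₂ ∘ (fun q : (κ ⊕ Ω) × Bool => sg q.2 (v₂ q.1)) =
      fun q : (κ ⊕ Ω) × Bool => sg q.2 (Sum.elim v w q.1) := by
    funext q; simp [map_sg, hv₂]
  have e3 : θ₂ ∘ (fun q : Λ × Bool => sg q.2 (z₂ q.1)) = fun q : Λ × Bool => sg q.2 (z q.1) := by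
    funext q; simp [map_sg, hz₂]
  have e4 : θ₁ ∘ (fun q : Λ × Bool => sg q.2 (z₁ q.1)) = fun q : Λ × Bool => sg q.2 (z q.1) := by
    funext q; simp [map_sg, hz₁]
  have e5 : θ₁ ∘ (fun q : κ × Bool => sg q.2 (u₁ q.1)) = fun q : κ × Bool => sg q.2 (u q.1) := by
    funext q; simp [map_sg, hu₁]
  refine thmC1 θ₁ θ₂ hθ₁ hθ₂ σ (IA := κ × Bool) (IB := (κ ⊕ Ω) × Bool) (IC := Λ × Bool)
    (fun q => (.inl q.1, !q.2))
    (fun q => sg q.2 (u₁ q.1)) (fun q => sg q.2 (u₂ q.1))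
    (fun q => sg q.2 (v₁ q.1)) (fun q => sg q.2 (v₂ q.1))
    (fun q => sg q.2 (z₁ q.1)) (fun q => sg q.2 (z₂ q.1))
    ?_ ?_ ?_ (fun q => ⟨(q.1, !q.2), sg_not _ _, sg_not _ _⟩)
    (fun q => ⟨(q.1, !q.2), sg_not _ _, sg_not _ _⟩)
    (fun q => (q.1, !q.2)) (fun q => by simp [sg_not])
    (fun q => Sum.elim 0 e q.1) ?_ ?_ ?_ ?_ ?_ ?_
  · rintro L ⟨j, ε⟩
    simp only [map_sg, map_sg', hu₁, hu₂, hu, sg_not]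
    cases ε <;> simp [sg, mul_comm, hv₂]
  · rintro L ⟨j | j, ε⟩ <;> simp [map_sg, map_sg', hv₁, hv₂, hv, hw']
  · rintro L ⟨j, ε⟩
    simp [map_sg, map_sg', hz₁, hz₂, hz]
  · rintro ⟨j | j, ε⟩
    · simp
    · cases ε <;> simp [sg, hv₁, he]
  · rintro ⟨j | j, ε⟩
    · simp
    · cases ε <;> simp [sg, hv₂, he]
  · rintro ⟨j | j, ε⟩
    · exact Or.inr ⟨(j, !ε), by simp⟩
    · exact Or.inl (he0 j)
  · rw [e1, e4, e5, Subgroup.closure_union, Subgroup.closure_union, closure_sg, closure_sg,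
      closure_sg, ← Subgroup.closure_union, ← Subgroup.closure_union, ← hgen, Set.Sum.elim_range]
    congr 1
    grind
  · rw [e1, closure_sg, Set.Sum.elim_range]
    exact hK₁
  · rw [Sum.comp_elim, e2, e3, Set.Sum.elim_range, Subgroup.closure_union, closure_sg, closure_sg,
      ← Subgroup.closure_union, Set.Sum.elim_range]
    exact hK₂

end FibreB
end FibreFP

/-! ### Part 7: abelian groups -/

namespace FibreFP

section Ab

lemma exists_split {V F : Type*} [AddCommGroup V] [AddCommGroup F] [Module.Free ℤ F]
    (f : V →ₗ[ℤ] F) (hf : Function.Surjective f) :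
    ∃ e : V ≃ₗ[ℤ] F × LinearMap.ker f, ∀ v, (e v).1 = f v := by
  obtain ⟨s, hs⟩ := f.exists_rightInverse_of_surjective (LinearMap.range_eq_top.2 hf)
  have hs' : ∀ x, f (s x) = x := fun x => LinearMap.congr_fun hs x
  let g : V →ₗ[ℤ] LinearMap.ker f :=
    LinearMap.codRestrict _ (LinearMap.id - s.comp f) (fun v => by simp [hs'])
  refine ⟨LinearEquiv.ofLinearMap (f.prod g) (s.coprod (LinearMap.ker f).subtype) ?_ ?_, fun v => rfl⟩
  · ext x
    · simp [hs']
    · simp [g, hs']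
    · simp
    · simp [g]
  · ext v
    simp [g]

lemma finite_torsion (V : Type*) [AddCommGroup V] [Module.Finite ℤ V] :
    Finite (Submodule.torsion ℤ V) :=
  Module.finite_of_fg_torsion _ (Submodule.torsion_isTorsion (R := ℤ) (M := V))

lemma finrank_mod_torsion (V : Type*) [AddCommGroup V] [Module.Finite ℤ V] :
    Module.finrank ℤ (V ⧸ Submodule.torsion ℤ V) = Module.finrank ℤ V := by
  have h := (Submodule.torsion ℤ V).finrank_quotient_add_finrank
  have h0 : Module.finrank ℤ (Submodule.torsion ℤ V) = 0 :=
    Module.finrank_eq_zero_iff_isTorsion.2 (Submodule.torsion_isTorsion (R := ℤ) (M := V))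
  omega

lemma exists_coords {V F ι κ : Type*} [AddCommGroup V] [AddCommGroup F] [Module.Free ℤ F]
    [Module.Finite ℤ V] [Fintype ι] [Fintype κ]
    (f : V →ₗ[ℤ] F) (hf : Function.Surjective f) (hF : Module.finrank ℤ F = Fintype.card ι)
    (hV : Module.finrank ℤ V = Fintype.card ι + Fintype.card κ) :
    ∃ e : V ≃ₗ[ℤ] (ι → ℤ) × (κ → ℤ) × Submodule.torsion ℤ V, ∀ v, (e v).1 = 0 ↔ f v = 0 := by
  have : Module.Finite ℤ F := Module.Finite.of_surjective f hf
  let T := Submodule.torsion ℤ V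
  have hT : T ≤ LinearMap.ker f := by
    intro t ht
    obtain ⟨a, ha⟩ := (Submodule.mem_torsion_iff _).1 ht
    rw [LinearMap.mem_ker]
    have h1 : (a : ℤ) • f t = 0 := by
      rw [← map_smul]
      have ha : (a : ℤ) • t = 0 := ha
      rw [ha, map_zero]
    exact (smul_eq_zero.1 h1).resolve_left (nonZeroDivisors.coe_ne_zero a)
  let g : (V ⧸ T) →ₗ[ℤ] F := T.liftQ f hT
  have hg : Function.Surjective g := by
    intro x
    obtain ⟨v, rfl⟩ := hf x
    exact ⟨T.mkQ v, by simp [g]⟩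
  obtain ⟨e₁, he₁⟩ := exists_split T.mkQ T.mkQ_surjective
  obtain ⟨e₂, he₂⟩ := exists_split g hg
  let e₃ : F ≃ₗ[ℤ] (ι → ℤ) := LinearEquiv.ofFinrankEq _ _ (by simp [hF])
  have hC : Module.finrank ℤ (LinearMap.ker g) = Fintype.card κ := by
    have h := e₂.finrank_eq
    rw [Module.finrank_prod, finrank_mod_torsion] at h
    omega
  let e₄ : LinearMap.ker g ≃ₗ[ℤ] (κ → ℤ) := LinearEquiv.ofFinrankEq _ _ (by simp [hC])
  let e₅ : LinearMap.ker T.mkQ ≃ₗ[ℤ] T := LinearEquiv.ofEq _ _ T.ker_mkQ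
  let e := (e₁.trans ((e₂.trans (e₃.prodCongr e₄)).prodCongr e₅)).trans
    (LinearEquiv.prodAssoc ℤ _ _ _)
  refine ⟨e, fun v => ?_⟩
  have : (e v).1 = e₃ (f v) := by
    simp [e, he₁, he₂, g]
  rw [this]
  simp

lemma pi_mem {S κ : Type*} [AddCommGroup S] [Fintype κ] [DecidableEq κ]
    (H : Subgroup (Multiplicative S)) (φ : (κ → ℤ) →+ S)
    (h : ∀ j, Multiplicative.ofAdd (φ (Pi.single j 1)) ∈ H) (c : κ → ℤ) :
    Multiplicative.ofAdd (φ c) ∈ H := by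
  rw [pi_eq_sum_univ' c, map_sum, ofAdd_sum]
  refine Subgroup.prod_mem _ fun j _ => ?_
  rw [map_zsmul, ofAdd_zsmul]
  refine Subgroup.zpow_mem _ ?_ _
  convert h j using 3

end Ab

section FG

/-- Enlarging a finitely generated subgroup by a finite quotient. -/
lemma fg_of_finite {G W : Type*} [Group G] [AddCommGroup W] (f : G →* Multiplicative W)
    (hK : f.ker.FG) (T : Subgroup (Multiplicative W)) [Finite T] : (T.comap f).FG := by
  let T' := {t : T // ∃ g, f g = t}
  choose g hg using fun t : T' => t.2
  have h : T.comap f = f.ker ⊔ Subgroup.closure (Set.range g) := by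
    apply le_antisymm
    · intro x hx
      let t : T' := ⟨⟨f x, hx⟩, x, rfl⟩
      have h1 : x = (x * (g t)⁻¹) * g t := by simp
      rw [h1]
      refine Subgroup.mul_mem_sup ?_ (Subgroup.subset_closure ⟨t, rfl⟩)
      rw [MonoidHom.mem_ker, map_mul, map_inv, hg t, mul_inv_cancel]
    · refine sup_le ?_ ((Subgroup.closure_le _).2 ?_)
      · intro x hx
        rw [Subgroup.mem_comap, MonoidHom.mem_ker.1 hx]
        exact T.one_mem
      · rintro _ ⟨t, rfl⟩
        change f (g t) ∈ T
        rw [hg t]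
        exact t.1.2
  rw [h]
  exact hK.sup ((Subgroup.fg_iff _).2 ⟨_, rfl, Set.finite_range g⟩)

end FG
end FibreFP

/-! ### Part 8: choice of coordinates -/

namespace FibreFP

section Coord

lemma fg_tors {G V W : Type*} [Group G] [AddCommGroup V] [AddCommGroup W] [Module.Finite ℤ W]
    (θ : G →* Multiplicative V) (f : V →ₗ[ℤ] W) {K K' : Subgroup G} (hfg : K.FG)
    (hK : ∀ g, g ∈ K ↔ f (θ g).toAdd = 0)
    (hK' : ∀ g, g ∈ K' ↔ (Submodule.torsion ℤ W).mkQ (f (θ g).toAdd) = 0) : K'.FG := by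
  let F : G →* Multiplicative W := (AddMonoidHom.toMultiplicative f.toAddMonoidHom).comp θ
  have hF : F.ker = K := by
    ext g
    rw [hK, MonoidHom.mem_ker]
    rfl
  let T : Subgroup (Multiplicative W) := AddSubgroup.toSubgroup (Submodule.torsion ℤ W).toAddSubgroup
  have : Finite T := finite_torsion W
  have h := fg_of_finite F (hF ▸ hfg) T
  convert h
  ext g
  rw [hK', Submodule.mkQ_apply, Submodule.Quotient.mk_eq_zero]
  rfl

/-- the shear map -/
def shear (A B C T : Type*) [AddCommGroup A] [AddCommGroup B] [AddCommGroup T]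
    [AddCommGroup C] (φ : A →+ C) : (A × B × C × T) ≃+ (A × B × C × T) where
  toFun q := (q.1, q.2.1, q.2.2.1 - φ q.1, q.2.2.2)
  invFun q := (q.1, q.2.1, q.2.2.1 + φ q.1, q.2.2.2)
  left_inv q := by simp
  right_inv q := by simp
  map_add' p q := by
    ext <;> simp
    abel

/-- coordinates -/
abbrev SS (k l : ℕ) (T : Type*) := (Fin k → ℤ) × (Fin l → ℤ) × (Fin k → ℤ) × T

theorem thmD0 {G₁ G₂ V W₁ W₂ : Type*} [Group G₁] [Group G₂]
    [AddCommGroup V] [AddCommGroup W₁] [AddCommGroup W₂]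
    [Group.IsFinitelyPresented G₁] [Group.IsFinitelyPresented G₂] [Module.Finite ℤ V]
    (θ₁ : G₁ →* Multiplicative V) (θ₂ : G₂ →* Multiplicative V)
    (hθ₁ : Function.Surjective θ₁) (hθ₂ : Function.Surjective θ₂)
    (f₁ : V →ₗ[ℤ] W₁) (f₂ : V →ₗ[ℤ] W₂)
    (hf₁ : Function.Surjective f₁) (hf₂ : Function.Surjective f₂)
    {K₁ : Subgroup G₁} {K₂ : Subgroup G₂} (hfg₁ : K₁.FG) (hfg₂ : K₂.FG)
    (hK₁ : ∀ g, g ∈ K₁ ↔ f₁ (θ₁ g).toAdd = 0) (hK₂ : ∀ g, g ∈ K₂ ↔ f₂ (θ₂ g).toAdd = 0)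
    {k m : ℕ} (hm : Module.finrank ℤ W₁ = m) (hk : Module.finrank ℤ W₂ = k)
    (hkm : Module.finrank ℤ V = k + m) (hle : k ≤ m) :
    ∃ τ : V ≃+ V, Group.IsFinitelyPresented (fib θ₁ θ₂ (AddEquiv.toMultiplicative τ)) := by
  obtain ⟨l, rfl⟩ := Nat.exists_eq_add_of_le hle
  have : Module.Finite ℤ W₁ := Module.Finite.of_surjective f₁ hf₁
  have : Module.Finite ℤ W₂ := Module.Finite.of_surjective f₂ hf₂
  let T := Submodule.torsion ℤ V
  have hTfin : Finite T := finite_torsion V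
  obtain ⟨e₁, he₁⟩ := exists_coords (ι := Fin k ⊕ Fin l) (κ := Fin k)
    ((Submodule.torsion ℤ W₁).mkQ.comp f₁) ((Submodule.mkQ_surjective _).comp hf₁)
    (by rw [finrank_mod_torsion, hm]; simp) (by rw [hkm]; simp; omega)
  obtain ⟨e₂, he₂⟩ := exists_coords (ι := Fin k) (κ := Fin l ⊕ Fin k)
    ((Submodule.torsion ℤ W₂).mkQ.comp f₂) ((Submodule.mkQ_surjective _).comp hf₂)
    (by rw [finrank_mod_torsion, hk]; simp) (by rw [hkm]; simp; omega)
  let d₁ : V ≃+ SS k l T := (e₁.trans (((LinearEquiv.sumArrowLequivProdArrow _ _ ℤ ℤ).prodCongr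
    (LinearEquiv.refl ℤ _)).trans (LinearEquiv.prodAssoc ℤ _ _ _))).toAddEquiv
  let d₂ : V ≃+ SS k l T := (e₂.trans ((LinearEquiv.refl ℤ _).prodCongr
    (((LinearEquiv.sumArrowLequivProdArrow _ _ ℤ ℤ).prodCongr
      (LinearEquiv.refl ℤ _)).trans (LinearEquiv.prodAssoc ℤ _ _ _)))).toAddEquiv
  have hd₁ : ∀ v, ((d₁ v).1 = 0 ∧ (d₁ v).2.1 = 0) ↔ (Submodule.torsion ℤ W₁).mkQ (f₁ v) = 0 := by
    intro v
    refine Iff.trans ?_ (he₁ v)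
    constructor
    · rintro ⟨h1, h2⟩
      funext j
      rcases j with j | j
      · exact congrFun h1 j
      · exact congrFun h2 j
    · intro h
      exact ⟨funext fun j => congrFun h (.inl j), funext fun j => congrFun h (.inr j)⟩
  have hd₂ : ∀ v, (d₂ v).1 = 0 ↔ (Submodule.torsion ℤ W₂).mkQ (f₂ v) = 0 := he₂
  let φu : (Fin k → ℤ) →+ SS k l T := AddMonoidHom.inl _ _
  let φz : (Fin l → ℤ) →+ SS k l T := (AddMonoidHom.inr _ _).comp (AddMonoidHom.inl _ _)
  let φv : (Fin k → ℤ) →+ SS k l T :=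
    (AddMonoidHom.inr _ _).comp ((AddMonoidHom.inr _ _).comp (AddMonoidHom.inl _ _))
  let φw : T →+ SS k l T :=
    (AddMonoidHom.inr _ _).comp ((AddMonoidHom.inr _ _).comp (AddMonoidHom.inr _ _))
  let u : Fin k → Multiplicative (SS k l T) := fun j => Multiplicative.ofAdd (φu (Pi.single j 1))
  let v : Fin k → Multiplicative (SS k l T) := fun j => Multiplicative.ofAdd (φv (Pi.single j 1))
  let z : Fin l → Multiplicative (SS k l T) := fun j => Multiplicative.ofAdd (φz (Pi.single j 1))
  let w : T → Multiplicative (SS k l T) := fun j => Multiplicative.ofAdd (φw j)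
  have hdec : ∀ s : Multiplicative (SS k l T), s = Multiplicative.ofAdd (φu s.toAdd.1) *
      Multiplicative.ofAdd (φz s.toAdd.2.1) * Multiplicative.ofAdd (φv s.toAdd.2.2.1) *
      Multiplicative.ofAdd (φw s.toAdd.2.2.2) := by
    intro s
    apply Multiplicative.toAdd.injective
    simp [φu, φz, φv, φw]
  have c1 : ∀ s, s ∈ Subgroup.closure (Set.range v ∪ Set.range w) ↔
      s.toAdd.1 = 0 ∧ s.toAdd.2.1 = 0 := by
    intro s
    constructor
    · intro hs
      induction hs using Subgroup.closure_induction with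
      | mem x hx =>
        rcases hx with ⟨j, rfl⟩ | ⟨j, rfl⟩ <;> simp [v, w, φv, φw]
      | one => simp
      | mul x y _ _ hx hy => simp [hx, hy]
      | inv x _ hx => simp [hx]
    · rintro ⟨h1, h2⟩
      rw [hdec s, h1, h2, φu.map_zero, φz.map_zero, ofAdd_zero, one_mul, one_mul]
      exact Subgroup.mul_mem _
        (pi_mem _ φv (fun j => Subgroup.subset_closure (Or.inl ⟨j, rfl⟩)) _)
        (Subgroup.subset_closure (Or.inr ⟨_, rfl⟩))
  have c2 : ∀ s, s ∈ Subgroup.closure (Set.range v ∪ Set.range w ∪ Set.range z) ↔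
      s.toAdd.1 = 0 := by
    intro s
    constructor
    · intro hs
      induction hs using Subgroup.closure_induction with
      | mem x hx =>
        rcases hx with (⟨j, rfl⟩ | ⟨j, rfl⟩) | ⟨j, rfl⟩ <;> simp [v, w, z, φv, φw, φz]
      | one => simp
      | mul x y _ _ hx hy => simp [hx, hy]
      | inv x _ hx => simp [hx]
    · intro h1
      rw [hdec s, h1, φu.map_zero, ofAdd_zero, one_mul]
      exact Subgroup.mul_mem _ (Subgroup.mul_mem _
        (pi_mem _ φz (fun j => Subgroup.subset_closure (Or.inr ⟨j, rfl⟩)) _)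
        (pi_mem _ φv (fun j => Subgroup.subset_closure (Or.inl (Or.inl ⟨j, rfl⟩))) _))
        (Subgroup.subset_closure (Or.inl (Or.inr ⟨_, rfl⟩)))
  let σ : ℕ → Multiplicative (SS k l T) ≃* Multiplicative (SS k l T) := fun L =>
    AddEquiv.toMultiplicative (shear (Fin k → ℤ) (Fin l → ℤ) (Fin k → ℤ) T
      (L • AddMonoidHom.id _))
  have hw : ∀ i, ∃ e, 0 < e ∧ w i ^ e = 1 := by
    intro t
    refine ⟨Nat.card T, Nat.card_pos, ?_⟩
    change Multiplicative.ofAdd (φw t) ^ _ = 1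
    rw [← ofAdd_nsmul, ← map_nsmul, card_nsmul_eq_zero', map_zero, ofAdd_zero]
  have hg : Subgroup.closure (Set.range u ∪ Set.range v ∪ Set.range z ∪ Set.range w) = ⊤ := by
    rw [eq_top_iff]
    intro s _
    rw [hdec s]
    refine Subgroup.mul_mem _ (Subgroup.mul_mem _ (Subgroup.mul_mem _ ?_ ?_) ?_) ?_
    · exact pi_mem _ φu (fun j => Subgroup.subset_closure (Or.inl (Or.inl (Or.inl ⟨j, rfl⟩)))) _
    · exact pi_mem _ φz (fun j => Subgroup.subset_closure (Or.inl (Or.inr ⟨j, rfl⟩))) _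
    · exact pi_mem _ φv (fun j => Subgroup.subset_closure (Or.inl (Or.inl (Or.inr ⟨j, rfl⟩)))) _
    · exact Subgroup.subset_closure (Or.inr ⟨_, rfl⟩)
  have hk1 : ((Subgroup.closure (Set.range v ∪ Set.range w)).comap
      ((AddEquiv.toMultiplicative d₁).toMonoidHom.comp θ₁)).FG := by
    exact fg_tors θ₁ f₁ hfg₁ hK₁ fun g => (c1 _).trans (hd₁ _)
  have hk2 : ((Subgroup.closure (Set.range v ∪ Set.range w ∪ Set.range z)).comap
      ((AddEquiv.toMultiplicative d₂).toMonoidHom.comp θ₂)).FG := by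
    exact fg_tors θ₂ f₂ hfg₂ hK₂ fun g => (c2 _).trans (hd₂ _)
  have h5 : ∀ L j, σ L (u j) = u j * (v j ^ L)⁻¹ := by
    intro L j
    apply Multiplicative.toAdd.injective
    simp [σ, u, v, φu, φv, shear]
  have h6 : ∀ L j, σ L (v j) = v j := by
    intro L j
    apply Multiplicative.toAdd.injective
    simp [σ, v, φv, shear]
  have h7 : ∀ L j, σ L (z j) = z j := by
    intro L j
    apply Multiplicative.toAdd.injective
    simp [σ, z, φz, shear]
  have h8 : ∀ L j, σ L (w j) = w j := by
    intro L j
    apply Multiplicative.toAdd.injective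
    simp [σ, w, φw, shear]
  obtain ⟨L, hL⟩ := thmC
    ((AddEquiv.toMultiplicative d₁).toMonoidHom.comp θ₁)
    ((AddEquiv.toMultiplicative d₂).toMonoidHom.comp θ₂)
    ((AddEquiv.toMultiplicative d₁).surjective.comp hθ₁)
    ((AddEquiv.toMultiplicative d₂).surjective.comp hθ₂)
    u v z w hw hg hk1 hk2 σ h5 h6 h7 h8
  refine ⟨(d₁.trans (shear (Fin k → ℤ) (Fin l → ℤ) (Fin k → ℤ) T
    (L • AddMonoidHom.id _))).trans d₂.symm, ?_⟩
  have hE : fib θ₁ θ₂ (AddEquiv.toMultiplicative ((d₁.trans (shear (Fin k → ℤ) (Fin l → ℤ)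
      (Fin k → ℤ) T (L • AddMonoidHom.id _))).trans d₂.symm)) =
      fib ((AddEquiv.toMultiplicative d₁).toMonoidHom.comp θ₁)
        ((AddEquiv.toMultiplicative d₂).toMonoidHom.comp θ₂) (σ L) := by
    ext q
    rw [mem_fib, mem_fib]
    change d₂.symm (shear (Fin k → ℤ) (Fin l → ℤ) (Fin k → ℤ) T
      (L • AddMonoidHom.id _) (d₁ (θ₁ q.1))) = θ₂ q.2 ↔
      shear (Fin k → ℤ) (Fin l → ℤ) (Fin k → ℤ) T
      (L • AddMonoidHom.id _) (d₁ (θ₁ q.1)) = d₂ (θ₂ q.2)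
    exact AddEquiv.symm_apply_eq _
  rw [hE]
  exact hL

end Coord
end FibreFP

/-! ### Part 9: the theorem -/

namespace FibreFP

section Final

lemma fp_iff {G : Type*} [Group G] : FinitelyPresentedGroup G ↔ Group.IsFinitelyPresented G := by
  constructor
  · rintro ⟨n, f, S, hf, hk⟩
    exact ⟨n, f, hf, S, S.finite_toSet, hk.symm⟩
  · rintro ⟨n, f, hf, S, hS, hk⟩
    exact ⟨n, f, hS.toFinset, hf, by simpa using hk.symm⟩

lemma ab_inj {G : Type*} [Group G] (K : Subgroup G) [K.Normal] (hK : commutator G ≤ K)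
    (q : G ⧸ K) (hq : Abelianization.of q = 1) : q = 1 := by
  have h1 : q ∈ commutator (G ⧸ K) := by
    rw [← Abelianization.ker_of]
    exact hq
  have h2 : commutator (G ⧸ K) = ⊥ := by
    rw [eq_bot_iff, commutator_def, Subgroup.commutator_le]
    intro a _ b _
    induction a using QuotientGroup.induction_on with
    | H a =>
      induction b using QuotientGroup.induction_on with
      | H b =>
        rw [Subgroup.mem_bot]
        exact (QuotientGroup.eq_one_iff _).2 (hK (Subgroup.commutator_mem_commutator
          (Subgroup.mem_top a) (Subgroup.mem_top b)))
  rw [h2] at h1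
  exact h1

lemma fg_of_fp {G : Type*} [Group G] [h : Group.IsFinitelyPresented G] : Group.FG G := by
  obtain ⟨n, f, hf, -⟩ := h.out
  exact Group.fg_of_surjective hf

lemma ab_surj {G : Type*} [Group G] : Function.Surjective (Abelianization.of (G := G)) :=
  fun x => QuotientGroup.mk_surjective x

theorem thmD {G₁ G₂ : Type*} [Group G₁] [Group G₂]
    [Group.IsFinitelyPresented G₁] [Group.IsFinitelyPresented G₂]
    (N₁ : Subgroup G₁) (N₂ : Subgroup G₂) [hN₁ : N₁.Normal] [hN₂ : N₂.Normal]
    (hc₁ : commutator G₁ ≤ N₁) (hc₂ : commutator G₂ ≤ N₂)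
    (iso : (G₁ ⧸ N₁) ≃* (G₂ ⧸ N₂))
    (K₁ : Subgroup G₁) (K₂ : Subgroup G₂) (hK₁n : K₁.Normal) (hK₂n : K₂.Normal)
    (hNK₁ : N₁ ≤ K₁) (hNK₂ : N₂ ≤ K₂) (hKfg₁ : K₁.FG) (hKfg₂ : K₂.FG)
    (m k : ℕ) (hm : rkQuot K₁ hK₁n = m) (hk : rkQuot K₂ hK₂n = k)
    (hsum₂ : k + m = rkQuot N₂ hN₂) (hle : k ≤ m) :
    ∃ μ : (G₁ ⧸ N₁) ≃* (G₂ ⧸ N₂), Group.IsFinitelyPresented (fibreProduct N₁ N₂ μ) := by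
  let A := Abelianization (G₂ ⧸ N₂)
  have : Group.FG G₂ := fg_of_fp
  have hAfg : Group.FG A := Group.fg_of_surjective (f := Abelianization.of.comp
    (QuotientGroup.mk' N₂)) (ab_surj.comp (QuotientGroup.mk'_surjective N₂))
  have hAfin : Module.Finite ℤ (Additive A) :=
    Module.Finite.iff_addGroup_fg.2 (GroupFG.iff_add_fg.1 hAfg)
  let θ₂ : G₂ →* Multiplicative (Additive A) := MonoidHom.mk'
    (fun g => Multiplicative.ofAdd (Additive.ofMul (Abelianization.of (g : G₂ ⧸ N₂))))
    (fun a b => by simp)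
  let θ₁ : G₁ →* Multiplicative (Additive A) := MonoidHom.mk'
    (fun g => Multiplicative.ofAdd (Additive.ofMul (Abelianization.of (iso (g : G₁ ⧸ N₁)))))
    (fun a b => by simp)
  let q₁ : (G₂ ⧸ N₂) →* (G₁ ⧸ K₁) :=
    (QuotientGroup.map N₁ K₁ (MonoidHom.id _) hNK₁).comp iso.symm.toMonoidHom
  let q₂ : (G₂ ⧸ N₂) →* (G₂ ⧸ K₂) := QuotientGroup.map N₂ K₂ (MonoidHom.id _) hNK₂
  let f₁ : Additive A →ₗ[ℤ] Additive (Abelianization (G₁ ⧸ K₁)) :=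
    (MonoidHom.toAdditive (Abelianization.map q₁)).toIntLinearMap
  let f₂ : Additive A →ₗ[ℤ] Additive (Abelianization (G₂ ⧸ K₂)) :=
    (MonoidHom.toAdditive (Abelianization.map q₂)).toIntLinearMap
  have hq₁ : ∀ g : G₁, q₁ (iso (g : G₁ ⧸ N₁)) = (g : G₁ ⧸ K₁) := by
    intro g
    simp [q₁]
    rfl
  have hq₂ : ∀ g : G₂, q₂ (g : G₂ ⧸ N₂) = (g : G₂ ⧸ K₂) := fun g => rfl
  have hf₁θ : ∀ g, f₁ (θ₁ g).toAdd = Additive.ofMul (Abelianization.of (g : G₁ ⧸ K₁)) := by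
    intro g
    rw [← hq₁ g]
    rfl
  have hf₂θ : ∀ g, f₂ (θ₂ g).toAdd = Additive.ofMul (Abelianization.of (g : G₂ ⧸ K₂)) := by
    intro g
    rfl
  have hf₁ : Function.Surjective f₁ := by
    intro x
    obtain ⟨y, hy⟩ := ab_surj x.toMul
    obtain ⟨g, rfl⟩ := QuotientGroup.mk_surjective y
    exact ⟨(θ₁ g).toAdd, by rw [hf₁θ, hy]; rfl⟩
  have hf₂ : Function.Surjective f₂ := by
    intro x
    obtain ⟨y, hy⟩ := ab_surj x.toMul
    obtain ⟨g, rfl⟩ := QuotientGroup.mk_surjective y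
    exact ⟨(θ₂ g).toAdd, by rw [hf₂θ, hy]; rfl⟩
  have hθ₂ : Function.Surjective θ₂ := by
    intro x
    obtain ⟨y, hy⟩ := ab_surj x.toAdd.toMul
    obtain ⟨g, rfl⟩ := QuotientGroup.mk_surjective y
    exact ⟨g, hy⟩
  have hθ₁ : Function.Surjective θ₁ := by
    intro x
    obtain ⟨y, hy⟩ := ab_surj x.toAdd.toMul
    obtain ⟨g, hg⟩ := QuotientGroup.mk_surjective (iso.symm y)
    refine ⟨g, ?_⟩
    have h : iso (g : G₁ ⧸ N₁) = y := by rw [hg]; simp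
    rw [← h] at hy
    exact hy
  obtain ⟨τ, hτ⟩ := thmD0 θ₁ θ₂ hθ₁ hθ₂ f₁ f₂ hf₁ hf₂ hKfg₁ hKfg₂
    (fun g => by
      rw [hf₁θ]
      constructor
      · intro h
        rw [(QuotientGroup.eq_one_iff g).2 h, map_one]
        rfl
      · intro h
        exact (QuotientGroup.eq_one_iff g).1 (ab_inj K₁ (hc₁.trans hNK₁) _ h))
    (fun g => by
      rw [hf₂θ]
      constructor
      · intro h
        rw [(QuotientGroup.eq_one_iff g).2 h, map_one]
        rfl
      · intro h
        exact (QuotientGroup.eq_one_iff g).1 (ab_inj K₂ (hc₂.trans hNK₂) _ h))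
    (k := k) (m := m) hm hk hsum₂.symm hle
  let E : (G₂ ⧸ N₂) ≃* A := MulEquiv.ofBijective Abelianization.of
    ⟨(injective_iff_map_eq_one _).2 (ab_inj N₂ hc₂), ab_surj⟩
  let τ' : A ≃* A := MulEquiv.toAdditive.symm τ
  refine ⟨iso.trans (E.trans (τ'.trans E.symm)), ?_⟩
  have hE : fibreProduct N₁ N₂ (iso.trans (E.trans (τ'.trans E.symm))) =
      fib θ₁ θ₂ (AddEquiv.toMultiplicative τ) := by
    ext q
    rw [mem_fib]
    change E.symm (τ' (E (iso (q.1 : G₁ ⧸ N₁)))) = (q.2 : G₂ ⧸ N₂) ↔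
      τ' (E (iso (q.1 : G₁ ⧸ N₁))) = E (q.2 : G₂ ⧸ N₂)
    exact MulEquiv.symm_apply_eq _
  rw [hE]
  exact hτ

/-- swapping the factors -/
lemma fp_swap {G₁ G₂ : Type*} [Group G₁] [Group G₂]
    (N₁ : Subgroup G₁) (N₂ : Subgroup G₂) [hN₁ : N₁.Normal] [hN₂ : N₂.Normal]
    (μ : (G₂ ⧸ N₂) ≃* (G₁ ⧸ N₁)) (h : Group.IsFinitelyPresented (fibreProduct N₂ N₁ μ)) :
    Group.IsFinitelyPresented (fibreProduct N₁ N₂ μ.symm) := by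
  have hm : ∀ q : G₁ × G₂, q ∈ fibreProduct N₁ N₂ μ.symm ↔ q.swap ∈ fibreProduct N₂ N₁ μ := by
    intro q
    change μ.symm (q.1 : G₁ ⧸ N₁) = (q.2 : G₂ ⧸ N₂) ↔ μ (q.2 : G₂ ⧸ N₂) = (q.1 : G₁ ⧸ N₁)
    rw [MulEquiv.symm_apply_eq, eq_comm]
  let e : fibreProduct N₂ N₁ μ ≃* fibreProduct N₁ N₂ μ.symm :=
    { toFun := fun q => ⟨q.1.swap, (hm _).2 q.2⟩
      invFun := fun q => ⟨q.1.swap, (hm _).1 q.2⟩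
      left_inv := fun q => rfl
      right_inv := fun q => rfl
      map_mul' := fun q r => rfl }
  exact Group.IsFinitelyPresented.equiv e

theorem main {G₁ G₂ : Type*} [Group G₁] [Group G₂]
    [Group.IsFinitelyPresented G₁] [Group.IsFinitelyPresented G₂]
    (N₁ : Subgroup G₁) (N₂ : Subgroup G₂) [hN₁ : N₁.Normal] [hN₂ : N₂.Normal]
    (hc₁ : commutator G₁ ≤ N₁) (hc₂ : commutator G₂ ≤ N₂)
    (iso : (G₁ ⧸ N₁) ≃* (G₂ ⧸ N₂))
    (K₁ : Subgroup G₁) (K₂ : Subgroup G₂) (hK₁n : K₁.Normal) (hK₂n : K₂.Normal)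
    (hNK₁ : N₁ ≤ K₁) (hNK₂ : N₂ ≤ K₂) (hKfg₁ : K₁.FG) (hKfg₂ : K₂.FG)
    (m k : ℕ) (hm : rkQuot K₁ hK₁n = m) (hk : rkQuot K₂ hK₂n = k)
    (hsum₁ : k + m = rkQuot N₁ hN₁) (hsum₂ : k + m = rkQuot N₂ hN₂) :
    ∃ μ : (G₁ ⧸ N₁) ≃* (G₂ ⧸ N₂), Group.IsFinitelyPresented (fibreProduct N₁ N₂ μ) := by
  rcases le_total k m with hle | hle
  · exact thmD N₁ N₂ hc₁ hc₂ iso K₁ K₂ hK₁n hK₂n hNK₁ hNK₂ hKfg₁ hKfg₂ m k hm hk hsum₂ hle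
  · obtain ⟨μ, hμ⟩ := thmD N₂ N₁ hc₂ hc₁ iso.symm K₂ K₁ hK₂n hK₁n hNK₂ hNK₁ hKfg₂ hKfg₁ k m hk hm
      (by omega) hle
    exact ⟨μ.symm, fp_swap N₁ N₂ μ hμ⟩

end Final
end FibreFP

/-- If `G₁, G₂` are finitely presented, `Gᵢ' ≤ Nᵢ`, `G₁/N₁ ≅ G₂/N₂`, and there are finitely
generated `Nᵢ ≤ Kᵢ ≤ Gᵢ` of co-ranks `m` and `k` with `k + m = rk G₁/N₁ = rk G₂/N₂`, then
some fibre product `H_μ` is finitely presented; moreover `H_μ ∩ G₁ = N₁`, `H_μ ∩ G₂ = N₂`. -/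
theorem exists_fp_fibre_product_of_fg_subgroups {G₁ G₂ : Type*} [Group G₁] [Group G₂]
    (hfp₁ : FinitelyPresentedGroup G₁) (hfp₂ : FinitelyPresentedGroup G₂)
    (N₁ : Subgroup G₁) (N₂ : Subgroup G₂) [hN₁ : N₁.Normal] [hN₂ : N₂.Normal]
    (hc₁ : commutator G₁ ≤ N₁) (hc₂ : commutator G₂ ≤ N₂)
    (hiso : Nonempty ((G₁ ⧸ N₁) ≃* (G₂ ⧸ N₂)))
    (K₁ : Subgroup G₁) (K₂ : Subgroup G₂) (hK₁n : K₁.Normal) (hK₂n : K₂.Normal)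
    (hNK₁ : N₁ ≤ K₁) (hNK₂ : N₂ ≤ K₂) (hKfg₁ : K₁.FG) (hKfg₂ : K₂.FG)
    (m k : ℕ) (hm : rkQuot K₁ hK₁n = m) (hk : rkQuot K₂ hK₂n = k)
    (hsum₁ : k + m = rkQuot N₁ hN₁) (hsum₂ : k + m = rkQuot N₂ hN₂) :
    ∃ μ : (G₁ ⧸ N₁) ≃* (G₂ ⧸ N₂),
      FinitelyPresentedGroup ↥(fibreProduct N₁ N₂ μ) ∧
      Subgroup.comap (MonoidHom.inl G₁ G₂) (fibreProduct N₁ N₂ μ) = N₁ ∧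
      Subgroup.comap (MonoidHom.inr G₁ G₂) (fibreProduct N₁ N₂ μ) = N₂ := by
  have := FibreFP.fp_iff.1 hfp₁
  have := FibreFP.fp_iff.1 hfp₂
  obtain ⟨iso⟩ := hiso
  obtain ⟨μ, hμ⟩ := FibreFP.main N₁ N₂ hc₁ hc₂ iso K₁ K₂ hK₁n hK₂n hNK₁ hNK₂ hKfg₁ hKfg₂ m k hm hk
    hsum₁ hsum₂
  refine ⟨μ, FibreFP.fp_iff.2 hμ, ?_, ?_⟩
  · ext g
    change μ (g : G₁ ⧸ N₁) = ((1 : G₂) : G₂ ⧸ N₂) ↔ _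
    rw [QuotientGroup.mk_one, MulEquiv.map_eq_one_iff, QuotientGroup.eq_one_iff]
  · ext g
    change μ ((1 : G₁) : G₁ ⧸ N₁) = (g : G₂ ⧸ N₂) ↔ _
    rw [QuotientGroup.mk_one, map_one, eq_comm, QuotientGroup.eq_one_iff]
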